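/- arXiv:2010.14719 — 3 statements merged into one kernel-verified Lean document; each statement's English description precedes it below -/
import Mathlib

section
/- Packing entropy of the whole space equals topological entropy: If {F_n} is a Følner sequence in G satisfying the growth condition, then h^P_top(X,{F_n}) = h_top(X,G), the topological entropy of (X,G). -/
open Filter Set MeasureTheory ENNReal Topology
open scoped Pointwise symmDiff NNReal

namespace AmenablePacking

variable {G X Y : Type*}

/-- The open dynamical (Bowen) ball of center `x` and radius `ε` over the finite set `F`. -/
def dynBall [PseudoMetricSpace X] (act : G → X → X) (F : Finset G) (x : X) (ε : ℝ) : Set X :=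
  {y | ∀ g ∈ F, dist (act g x) (act g y) < ε}

/-- The closed dynamical (Bowen) ball of center `x` and radius `ε` over the finite set `F`. -/
def dynClosedBall [PseudoMetricSpace X] (act : G → X → X) (F : Finset G) (x : X) (ε : ℝ) :
    Set X :=
  {y | ∀ g ∈ F, dist (act g x) (act g y) ≤ ε}

/-- The packing pre-measure `P(Z, N, ε, s, {F_n})`: the supremum of `∑ᵢ exp (- s |F_{n_i}|)` over
all finite or countable pairwise disjoint families of closed Bowen balls with centers in `Z`
and indices `n_i ≥ N`. -/
noncomputable def packP [PseudoMetricSpace X] (act : G → X → X) (Fs : ℕ → Finset G) (Z : Set X)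
    (N : ℕ) (ε s : ℝ) : ℝ≥0∞ :=
  ⨆ (t : Set ℕ) (c : ℕ → X × ℕ) (_ : ∀ i ∈ t, (c i).1 ∈ Z ∧ N ≤ (c i).2)
    (_ : ∀ i ∈ t, ∀ j ∈ t, i ≠ j →
      Disjoint (dynClosedBall act (Fs (c i).2) (c i).1 ε)
        (dynClosedBall act (Fs (c j).2) (c j).1 ε)),
    ∑' i : t, ENNReal.ofReal (Real.exp (-s * ((Fs (c (i : ℕ)).2).card : ℝ)))

/-- `P(Z, ε, s, {F_n}) = lim_{N → ∞} P(Z, N, ε, s, {F_n})`; the quantity is non-increasing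
in `N`, so the limit equals the infimum. -/
noncomputable def packPLim [PseudoMetricSpace X] (act : G → X → X) (Fs : ℕ → Finset G)
    (Z : Set X) (ε s : ℝ) : ℝ≥0∞ :=
  ⨅ N : ℕ, packP act Fs Z N ε s

/-- `𝒫(Z, ε, s, {F_n})`: the countably subadditive envelope of `P(·, ε, s, {F_n})`. -/
noncomputable def packOuter [PseudoMetricSpace X] (act : G → X → X) (Fs : ℕ → Finset G)
    (Z : Set X) (ε s : ℝ) : ℝ≥0∞ :=
  ⨅ (Zs : ℕ → Set X) (_ : Z ⊆ ⋃ i, Zs i), ∑' i, packPLim act Fs (Zs i) ε s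

/-- `h^P_top(Z, ε, {F_n})`: the critical value of `s ≥ 0` at which `𝒫(Z, ε, s, {F_n})` jumps
from `+∞` to `0`. -/
noncomputable def packEntEps [PseudoMetricSpace X] (act : G → X → X) (Fs : ℕ → Finset G)
    (Z : Set X) (ε : ℝ) : ℝ≥0∞ :=
  ⨅ (s : ℝ≥0) (_ : packOuter act Fs Z ε (s : ℝ) = 0), (s : ℝ≥0∞)

/-- The amenable packing topological entropy
`h^P_top(Z, {F_n}) = lim_{ε → 0} h^P_top(Z, ε, {F_n})`. -/
noncomputable def packEnt [PseudoMetricSpace X] (act : G → X → X) (Fs : ℕ → Finset G)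
    (Z : Set X) : ℝ≥0∞ :=
  ⨆ (ε : ℝ) (_ : 0 < ε), packEntEps act Fs Z ε

/-- The Bowen pre-measure `ℳ(Z, N, ε, s, {F_n})`: the infimum of `∑ᵢ exp (- s |F_{n_i}|)` over
all finite or countable families of open Bowen balls with indices `n_i ≥ N` covering `Z`. -/
noncomputable def bowenM [PseudoMetricSpace X] (act : G → X → X) (Fs : ℕ → Finset G) (Z : Set X)
    (N : ℕ) (ε s : ℝ) : ℝ≥0∞ :=
  ⨅ (t : Set ℕ) (c : ℕ → X × ℕ) (_ : ∀ i ∈ t, N ≤ (c i).2)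
    (_ : Z ⊆ ⋃ i ∈ t, dynBall act (Fs (c i).2) (c i).1 ε),
    ∑' i : t, ENNReal.ofReal (Real.exp (-s * ((Fs (c (i : ℕ)).2).card : ℝ)))

/-- `ℳ(Z, s, {F_n}) = lim_{ε → 0} lim_{N → ∞} ℳ(Z, N, ε, s, {F_n})`. -/
noncomputable def bowenMLim [PseudoMetricSpace X] (act : G → X → X) (Fs : ℕ → Finset G)
    (Z : Set X) (s : ℝ) : ℝ≥0∞ :=
  ⨆ (ε : ℝ) (_ : 0 < ε), ⨆ N : ℕ, bowenM act Fs Z N ε s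

/-- The amenable Bowen topological entropy `h^B_top(Z, {F_n})`: the critical value of `s ≥ 0`
at which `ℳ(Z, s, {F_n})` jumps from `+∞` to `0`. -/
noncomputable def bowenEnt [PseudoMetricSpace X] (act : G → X → X) (Fs : ℕ → Finset G)
    (Z : Set X) : ℝ≥0∞ :=
  ⨅ (s : ℝ≥0) (_ : bowenMLim act Fs Z (s : ℝ) = 0), (s : ℝ≥0∞)

/-- `E` is an `(F, ε)`-separated set: distinct points are at `d_F`-distance `> ε`. -/
def IsDynSeparated [PseudoMetricSpace X] (act : G → X → X) (F : Finset G) (ε : ℝ)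
    (E : Set X) : Prop :=
  ∀ x ∈ E, ∀ y ∈ E, x ≠ y → ∃ g ∈ F, ε < dist (act g x) (act g y)

/-- `s_F(Z, ε)`: the maximal cardinality of an `(F, ε)`-separated subset of `Z`. -/
noncomputable def sepNum [PseudoMetricSpace X] (act : G → X → X) (F : Finset G) (Z : Set X)
    (ε : ℝ) : ℕ :=
  sSup {k : ℕ | ∃ E : Finset X, ↑E ⊆ Z ∧ IsDynSeparated act F ε ↑E ∧ E.card = k}

/-- The upper capacity entropy of `Z` at scale `ε`:
`limsup_n (1/|F_n|) log s_{F_n}(Z, ε)`. -/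
noncomputable def ucEntEps [PseudoMetricSpace X] (act : G → X → X) (Fs : ℕ → Finset G)
    (Z : Set X) (ε : ℝ) : ℝ≥0∞ :=
  limsup (fun n => ENNReal.ofReal (Real.log ((sepNum act (Fs n) Z ε : ℝ)) / ((Fs n).card : ℝ)))
    atTop

/-- The upper capacity topological entropy `h^{UC}_top(Z, {F_n})`. -/
noncomputable def ucEnt [PseudoMetricSpace X] (act : G → X → X) (Fs : ℕ → Finset G)
    (Z : Set X) : ℝ≥0∞ :=
  ⨆ (ε : ℝ) (_ : 0 < ε), ucEntEps act Fs Z ε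

/-- The upper local entropy `h̄^loc_μ(Z, {F_n}) =
`∫_Z lim_{ε→0} limsup_n -(1/|F_n|) log μ(B_{F_n}(x, ε)) dμ`. -/
noncomputable def upperLocalEnt [PseudoMetricSpace X] [MeasurableSpace X] (act : G → X → X)
    (Fs : ℕ → Finset G) (μ : Measure X) (Z : Set X) : ℝ≥0∞ :=
  ∫⁻ x in Z, ⨆ (ε : ℝ) (_ : 0 < ε),
    limsup (fun n =>
      ENNReal.ofReal (-Real.log ((μ (dynBall act (Fs n) x ε)).toReal) / ((Fs n).card : ℝ)))
      atTop ∂μ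

/-- A Følner sequence: a sequence of nonempty finite subsets of `G` which is asymptotically
invariant, i.e. `|g F_n ∆ F_n| / |F_n| → 0` for every `g ∈ G`. -/
def Folner [Group G] [DecidableEq G] (Fs : ℕ → Finset G) : Prop :=
  (∀ n, (Fs n).Nonempty) ∧
    ∀ g : G,
      Tendsto (fun n => ((((Fs n).image fun h => g * h) ∆ Fs n).card : ℝ) / ((Fs n).card : ℝ))
        atTop (nhds 0)

/-- A tempered sequence: `|⋃_{k < n} F_k⁻¹ F_n| ≤ C |F_n|` for a constant `C > 0`. -/
def Tempered [Group G] [DecidableEq G] (Fs : ℕ → Finset G) : Prop :=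
  ∃ C : ℝ, 0 < C ∧
    ∀ n : ℕ, ((((Finset.range n).biUnion fun k => (Fs k)⁻¹ * Fs n).card : ℝ))
      ≤ C * ((Fs n).card : ℝ)

/-- The growth condition `lim_n |F_n| / log n = +∞`. -/
def GrowthCond (Fs : ℕ → Finset G) [Group G] : Prop :=
  Tendsto (fun n => ((Fs n).card : ℝ) / Real.log (n : ℝ)) atTop atTop

/-- The static (Shannon) entropy of the finite measurable partition of `X` induced by a map
into a finite set. -/
noncomputable def partEnt [MeasurableSpace X] (μ : Measure X) {ι : Type*} [Fintype ι]
    (P : X → ι) : ℝ :=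
  ∑ i : ι, Real.negMulLog ((μ (P ⁻¹' {i})).toReal)

/-- The measure-theoretic (Kolmogorov–Sinai) entropy `h_μ(X, G)` of the action w.r.t. the
invariant measure `μ`, computed along the Følner sequence `{F_n}`: the supremum over finite
measurable partitions `P` of `lim_n (1/|F_n|) H_μ(⋁_{g ∈ F_n} (act g)⁻¹ P)`. -/
noncomputable def measEnt [MeasurableSpace X] [DecidableEq G] (act : G → X → X)
    (Fs : ℕ → Finset G) (μ : Measure X) : ℝ≥0∞ :=
  ⨆ (k : ℕ) (P : X → Fin k) (_ : Measurable P),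
    limsup (fun n => ENNReal.ofReal
      ((partEnt μ fun x (g : (Fs n : Finset G)) => P (act (g : G) x)) / ((Fs n).card : ℝ)))
      atTop

/-- The set of generic points of `μ` w.r.t. `{F_n}`. -/
def genericPoints [TopologicalSpace X] [MeasurableSpace X] (act : G → X → X)
    (Fs : ℕ → Finset G) (μ : Measure X) : Set X :=
  {x | ∀ f : C(X, ℝ),
    Tendsto (fun n => (∑ g ∈ Fs n, f (act g x)) / ((Fs n).card : ℝ)) atTop
      (nhds (∫ y, f y ∂μ))}

/-- `μ` is invariant under the action. -/
def InvariantMeasure [MeasurableSpace X] (act : G → X → X) (μ : Measure X) : Prop :=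
  ∀ (g : G) (s : Set X), MeasurableSet s → μ (act g ⁻¹' s) = μ s

/-- The action is ergodic w.r.t. `μ`: every invariant measurable set is null or conull. -/
def ErgodicAction [MeasurableSpace X] (act : G → X → X) (μ : Measure X) : Prop :=
  ∀ s : Set X, MeasurableSet s → (∀ g : G, act g ⁻¹' s = s) → μ s = 0 ∨ μ s = 1

section Entropy

variable {Ω I α : Type*} [Fintype Ω]

open Classical in
/-- The set of points with the same labels as `x` over all indices in `S`. -/
noncomputable def cylinder (p : I → Ω → α) (S : Finset I) (x : Ω) : Finset Ω :=
  Finset.univ.filter fun y => ∀ g ∈ S, p g y = p g x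

/-- `|Ω|` times the Shannon entropy, under the uniform distribution on `Ω`, of the labels over
`S`. -/
noncomputable def uniformEnt (p : I → Ω → α) (S : Finset I) : ℝ :=
  ∑ x, Real.log (Fintype.card Ω / ((cylinder p S x).card : ℝ))

theorem mem_cylinder {p : I → Ω → α} {S : Finset I} {x y : Ω} :
    y ∈ cylinder p S x ↔ ∀ g ∈ S, p g y = p g x := by
  simp [cylinder]

theorem cylinder_card_pos (p : I → Ω → α) (S : Finset I) (x : Ω) :
    (0 : ℝ) < (cylinder p S x).card := by
  exact_mod_cast Finset.card_pos.2 ⟨x, mem_cylinder.2 fun _ _ => rfl⟩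

theorem cylinder_eq_of_mem {p : I → Ω → α} {S : Finset I} {x y : Ω}
    (h : y ∈ cylinder p S x) : cylinder p S y = cylinder p S x := by
  ext z
  rw [mem_cylinder] at h
  simp only [mem_cylinder]
  exact forall₂_congr fun g hg => by rw [h g hg]

theorem cylinder_anti (p : I → Ω → α) {S T : Finset I} (h : S ⊆ T) (x : Ω) :
    cylinder p T x ⊆ cylinder p S x := fun y hy => by
  rw [mem_cylinder] at hy ⊢
  exact fun g hg => hy g (h hg)

theorem card_univ_pos (x : Ω) : (0 : ℝ) < Fintype.card Ω := by
  exact_mod_cast Fintype.card_pos_iff.2 ⟨x⟩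

theorem uniformEnt_mono (p : I → Ω → α) {S T : Finset I} (h : S ⊆ T) :
    uniformEnt p S ≤ uniformEnt p T := by
  refine Finset.sum_le_sum fun x _ => ?_
  have h1 := cylinder_card_pos p T x
  have h2 := card_univ_pos x
  have h3 : ((cylinder p T x).card : ℝ) ≤ (cylinder p S x).card := by
    exact_mod_cast Finset.card_le_card (cylinder_anti p h x)
  exact Real.log_le_log (by have := cylinder_card_pos p S x; positivity) (by gcongr)

theorem uniformEnt_empty (p : I → Ω → α) : uniformEnt p ∅ = 0 := by
  refine Finset.sum_eq_zero fun x _ => ?_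
  have : cylinder p ∅ x = Finset.univ := by ext; simp [mem_cylinder]
  rw [this, Finset.card_univ, div_self (card_univ_pos x).ne', Real.log_one]

theorem sum_inv_cylinder_inter_le [DecidableEq I] [DecidableEq Ω] (p : I → Ω → α) (A B : Finset I)
    (y z : Ω) :
    ∑ x, (if x ∈ cylinder p A y ∧ x ∈ cylinder p B z then
      ((cylinder p (A ∪ B) x).card : ℝ)⁻¹ else 0) ≤ 1 := by
  rw [← Finset.sum_filter]
  rcases (Finset.univ.filter fun x => x ∈ cylinder p A y ∧ x ∈ cylinder p B z).eq_empty_or_nonempty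
    with h | ⟨w, hw⟩
  · rw [h]; simp
  have hsub : ∀ x ∈ Finset.univ.filter fun x => x ∈ cylinder p A y ∧ x ∈ cylinder p B z,
      x ∈ cylinder p (A ∪ B) w := by
    intro x hx
    simp only [Finset.mem_filter, Finset.mem_univ, true_and, mem_cylinder] at hx hw ⊢
    intro g hg
    rcases Finset.mem_union.1 hg with hg | hg
    · rw [hx.1 g hg, hw.1 g hg]
    · rw [hx.2 g hg, hw.2 g hg]
  calc _ = ∑ x ∈ Finset.univ.filter fun x => x ∈ cylinder p A y ∧ x ∈ cylinder p B z,
        ((cylinder p (A ∪ B) w).card : ℝ)⁻¹ :=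
        Finset.sum_congr rfl fun x hx => by rw [cylinder_eq_of_mem (hsub x hx)]
    _ ≤ ∑ x ∈ cylinder p (A ∪ B) w, ((cylinder p (A ∪ B) w).card : ℝ)⁻¹ :=
        Finset.sum_le_sum_of_subset_of_nonneg hsub fun _ _ _ => by positivity
    _ = 1 := by
        rw [Finset.sum_const, nsmul_eq_mul, mul_inv_cancel₀ (cylinder_card_pos _ _ _).ne']

theorem sum_cylinder_ratio_le [DecidableEq I] (p : I → Ω → α) (A B : Finset I) :
    ∑ x, ((cylinder p A x).card * (cylinder p B x).card : ℝ) /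
      ((cylinder p (A ∪ B) x).card * (cylinder p (A ∩ B) x).card) ≤ Fintype.card Ω := by
  classical
  have hsymm : ∀ (S : Finset I) (x y : Ω), y ∈ cylinder p S x ↔ x ∈ cylinder p S y := by
    intro S x y
    simp only [mem_cylinder]
    exact forall₂_congr fun g _ => eq_comm
  have key : ∀ x, ((cylinder p A x).card * (cylinder p B x).card : ℝ) /
      ((cylinder p (A ∪ B) x).card * (cylinder p (A ∩ B) x).card) =
      ∑ y, ∑ z, (if z ∈ cylinder p (A ∩ B) y then ((cylinder p (A ∩ B) y).card : ℝ)⁻¹ *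
        (if x ∈ cylinder p A y ∧ x ∈ cylinder p B z then
          ((cylinder p (A ∪ B) x).card : ℝ)⁻¹ else 0) else 0) := by
    intro x
    have e1 : ∀ S : Finset I, ((cylinder p S x).card : ℝ) =
        ∑ y, if y ∈ cylinder p S x then (1 : ℝ) else 0 := by
      intro S; simp
    rw [e1 A, e1 B, Finset.sum_mul_sum, Finset.sum_div]
    refine Finset.sum_congr rfl fun y _ => ?_
    rw [Finset.sum_div]
    refine Finset.sum_congr rfl fun z _ => ?_
    by_cases hy : y ∈ cylinder p A x
    · by_cases hz : z ∈ cylinder p B x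
      · have hyR : y ∈ cylinder p (A ∩ B) x := cylinder_anti p Finset.inter_subset_left x hy
        have hzR : z ∈ cylinder p (A ∩ B) x := cylinder_anti p Finset.inter_subset_right x hz
        rw [← cylinder_eq_of_mem hyR] at hzR ⊢
        rw [if_pos hy, if_pos hz, if_pos hzR, if_pos ⟨(hsymm _ _ _).1 hy, (hsymm _ _ _).1 hz⟩]
        rw [one_mul, one_div, mul_inv, mul_comm]
      · have : x ∉ cylinder p B z := fun h => hz ((hsymm _ _ _).1 h)
        simp [hz, this]
    · have : x ∉ cylinder p A y := fun h => hy ((hsymm _ _ _).1 h)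
      simp [hy, this]
  simp_rw [key]
  rw [Finset.sum_comm]
  calc _ ≤ ∑ y : Ω, (1 : ℝ) := Finset.sum_le_sum fun y _ => ?_
    _ = Fintype.card Ω := by simp
  rw [Finset.sum_comm]
  calc _ ≤ ∑ z, if z ∈ cylinder p (A ∩ B) y then ((cylinder p (A ∩ B) y).card : ℝ)⁻¹ else 0 := by
        refine Finset.sum_le_sum fun z _ => ?_
        by_cases hz : z ∈ cylinder p (A ∩ B) y
        · simp only [if_pos hz]
          rw [← Finset.mul_sum]
          exact mul_le_of_le_one_right (by positivity) (sum_inv_cylinder_inter_le p A B y z)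
        · simp [hz]
    _ = 1 := by
        simp [mul_inv_cancel₀ (cylinder_card_pos p (A ∩ B) y).ne']

theorem uniformEnt_union_add_inter_le [DecidableEq I] (p : I → Ω → α) (A B : Finset I) :
    uniformEnt p (A ∪ B) + uniformEnt p (A ∩ B) ≤ uniformEnt p A + uniformEnt p B := by
  have h := sum_cylinder_ratio_le p A B
  rw [← sub_nonpos]
  simp only [uniformEnt, ← Finset.sum_add_distrib, ← Finset.sum_sub_distrib]
  calc _ ≤ ∑ x, (((cylinder p A x).card * (cylinder p B x).card : ℝ) /
      ((cylinder p (A ∪ B) x).card * (cylinder p (A ∩ B) x).card) - 1) := by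
        refine Finset.sum_le_sum fun x _ => ?_
        have h0 := card_univ_pos x
        have h1 := cylinder_card_pos p A x
        have h2 := cylinder_card_pos p B x
        have h3 := cylinder_card_pos p (A ∪ B) x
        have h4 := cylinder_card_pos p (A ∩ B) x
        refine le_trans (le_of_eq ?_) (Real.log_le_sub_one_of_pos (by positivity))
        rw [Real.log_div (by positivity) (by positivity), Real.log_div (by positivity)
          (by positivity), Real.log_div (by positivity) (by positivity), Real.log_div
          (by positivity) (by positivity), Real.log_div (by positivity) (by positivity),
          Real.log_mul (by positivity) (by positivity), Real.log_mul (by positivity)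
          (by positivity)]
        ring
    _ ≤ 0 := by
        rw [Finset.sum_sub_distrib]
        simpa using h

/-- Shearer's inequality for the entropy of the labels. -/
theorem mul_uniformEnt_le_sum [DecidableEq I] (p : I → Ω → α) {J : Type*} (C : Finset J)
    (S : J → Finset I) (k : ℕ) (F : Finset I)
    (hk : ∀ g ∈ F, k ≤ (C.filter fun c => g ∈ S c).card) :
    k * uniformEnt p F ≤ ∑ c ∈ C, uniformEnt p (S c) := by
  suffices h : k * uniformEnt p F ≤ ∑ c ∈ C, uniformEnt p (S c ∩ F) from
    h.trans (Finset.sum_le_sum fun c _ => uniformEnt_mono p Finset.inter_subset_left)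
  induction F using Finset.induction_on with
  | empty => simp [uniformEnt_empty]
  | insert g F hg ih =>
    have ih := ih fun a ha => hk a (Finset.mem_insert_of_mem ha)
    have hk := hk g (Finset.mem_insert_self g F)
    set δ := uniformEnt p (insert g F) - uniformEnt p F with hδ
    have hδ0 : 0 ≤ δ := sub_nonneg.2 (uniformEnt_mono p (Finset.subset_insert _ _))
    have hstep : ∀ c ∈ C, uniformEnt p (S c ∩ F) + (if g ∈ S c then δ else 0) ≤
        uniformEnt p (S c ∩ insert g F) := by
      intro c _
      split_ifs with hc
      · have := uniformEnt_union_add_inter_le p (S c ∩ insert g F) F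
        have e1 : S c ∩ insert g F ∪ F = insert g F := by
          ext a; simp only [Finset.mem_union, Finset.mem_inter, Finset.mem_insert]
          constructor
          · rintro (⟨_, h⟩ | h) <;> simp_all
          · rintro (rfl | h) <;> simp_all
        have e2 : S c ∩ insert g F ∩ F = S c ∩ F := by
          ext a; simp only [Finset.mem_inter, Finset.mem_insert]; tauto
        rw [e1, e2] at this
        linarith
      · rw [Finset.inter_insert_of_notMem hc, add_zero]
    have hsum := Finset.sum_le_sum hstep
    rw [Finset.sum_add_distrib, ← Finset.sum_filter, Finset.sum_const, nsmul_eq_mul] at hsum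
    have : (k : ℝ) * δ ≤ (C.filter fun c => g ∈ S c).card * δ := by gcongr
    have e : (k : ℝ) * uniformEnt p (insert g F) = k * uniformEnt p F + k * δ := by
      rw [hδ]; ring
    linarith

/-- Gibbs' inequality: the entropy is at most the expected length of any code. -/
theorem uniformEnt_le_sum_log_inv [DecidableEq I] [Fintype α] (p : I → Ω → α) (S : Finset I)
    (q : (S → α) → ℝ) (hq : ∀ b, 0 < q b) (hq1 : ∑ b, q b ≤ 1) :
    uniformEnt p S ≤ ∑ x, Real.log (q fun g => p g x)⁻¹ := by
  classical
  have hcard : ∀ x, (cylinder p S x) =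
      Finset.univ.filter fun y => (fun g : S => p g y) = fun g : S => p g x := by
    intro x; ext y
    simp [mem_cylinder, funext_iff]
  have hsum : ∑ x, (q fun g => p g x) / ((cylinder p S x).card : ℝ) ≤ 1 := by
    rw [← Finset.sum_fiberwise Finset.univ (fun x (g : S) => p g x)]
    refine le_trans (Finset.sum_le_sum fun b _ => ?_) hq1
    calc _ = ∑ x ∈ Finset.univ.filter fun x => (fun g : S => p g x) = b,
          q b / ((Finset.univ.filter fun x => (fun g : S => p g x) = b).card : ℝ) := by
          refine Finset.sum_congr rfl fun x hx => ?_
          have := (Finset.mem_filter.1 hx).2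
          rw [hcard, this]
      _ ≤ q b := by
          rw [Finset.sum_const, nsmul_eq_mul]
          rcases eq_or_ne ((Finset.univ.filter fun x => (fun g : S => p g x) = b).card : ℝ) 0
            with h | h
          · rw [h, zero_mul]; exact (hq b).le
          · rw [mul_div_cancel₀ _ h]
  rw [← sub_nonpos, uniformEnt, ← Finset.sum_sub_distrib]
  calc _ ≤ ∑ x, (Fintype.card Ω * ((q fun g => p g x) / ((cylinder p S x).card : ℝ)) - 1) := by
        refine Finset.sum_le_sum fun x _ => ?_
        have h0 := card_univ_pos x
        have h1 := cylinder_card_pos p S x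
        have h2 := hq fun g => p g x
        refine le_trans (le_of_eq ?_) (Real.log_le_sub_one_of_pos (by positivity))
        rw [Real.log_div (by positivity) (by positivity), Real.log_inv, Real.log_mul
          (by positivity) (by positivity), Real.log_div (by positivity) (by positivity)]
        ring
    _ ≤ 0 := by
        rw [Finset.sum_sub_distrib, ← Finset.mul_sum]
        have : (0 : ℝ) ≤ Fintype.card Ω := by positivity
        simp only [Finset.sum_const, Finset.card_univ, nsmul_eq_mul, mul_one]
        nlinarith

end Entropy

section Coding

variable {Ω I α J : Type*} [Fintype Ω] [DecidableEq I] [Fintype α] [Nonempty α]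

theorem uniformEnt_le_card_mul (p : I → Ω → α) (S : Finset I) :
    uniformEnt p S ≤ Fintype.card Ω * (S.card * Real.log (Fintype.card α)) := by
  have hL : (0 : ℝ) < Fintype.card α := by exact_mod_cast Fintype.card_pos
  refine (uniformEnt_le_sum_log_inv p S (fun _ => ((Fintype.card α : ℝ) ^ S.card)⁻¹)
    (fun _ => by positivity) ?_).trans (le_of_eq ?_)
  · simp
  · simp

/-- Entropy bound for labels which, outside of an exceptional set of points, agree with one of
finitely many words up to prescribed errors. -/
theorem uniformEnt_le_of_words (p : I → Ω → α) (S : Finset I) (D : Finset J) (hD : D.Nonempty)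
    (r : J → I → α) (U : Set Ω) (W : I → Set Ω)
    (hU : ∀ x ∈ U, ∃ z ∈ D, ∀ g ∈ S, p g x = r z g ∨ x ∈ W g)
    {θ : ℝ} (hθ : 0 < θ) (hθ1 : θ < 1) :
    uniformEnt p S ≤ Fintype.card Ω *
        (Real.log 2 + Real.log D.card + S.card * Real.log (1 - θ)⁻¹) +
      (Uᶜ.ncard) * (S.card * Real.log (Fintype.card α)) +
      (∑ g ∈ S, ((W g).ncard : ℝ)) * Real.log (Fintype.card α / θ) := by
  classical
  have hL : (1 : ℝ) ≤ Fintype.card α := by exact_mod_cast Fintype.card_pos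
  have hDc : (1 : ℝ) ≤ D.card := by exact_mod_cast hD.card_pos
  set L : ℝ := (Fintype.card α : ℝ) with hLdef
  have h1θ : 0 < 1 - θ := by linarith
  have hlogL : 0 ≤ Real.log L := Real.log_nonneg hL
  have hlogD : 0 ≤ Real.log D.card := Real.log_nonneg hDc
  have hlogθ : 0 ≤ Real.log (1 - θ)⁻¹ :=
    Real.log_nonneg (by rw [one_le_inv₀ h1θ]; linarith)
  have hlogLθ : 0 ≤ Real.log (L / θ) :=
    Real.log_nonneg (by rw [le_div_iff₀ hθ]; linarith)
  set w : α → α → ℝ := fun a b => (if a = b then 1 - θ else 0) + θ / L with hw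
  have hw0 : ∀ a b, θ / L ≤ w a b := by
    intro a b; simp only [hw]; split_ifs <;> linarith
  have hwpos : ∀ a b, 0 < w a b := fun a b => lt_of_lt_of_le (by positivity) (hw0 a b)
  have hw1 : ∀ a, 1 - θ ≤ w a a := by
    intro a; simp only [hw, if_true]
    have : 0 ≤ θ / L := by positivity
    linarith
  have hwsum : ∀ b, ∑ a, w a b = 1 := by
    intro b
    simp only [hw, Finset.sum_add_distrib, Finset.sum_ite_eq', Finset.mem_univ, if_true,
      Finset.sum_const, Finset.card_univ, nsmul_eq_mul]
    rw [← hLdef]; field_simp; ring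
  set q : (S → α) → ℝ := fun b =>
    (2 * D.card : ℝ)⁻¹ * ∑ z ∈ D, ∏ g : S, w (b g) (r z g) + (2 * L ^ S.card)⁻¹ with hq
  have hprod : ∀ (b : S → α) (z : J), 0 < ∏ g : S, w (b g) (r z g) :=
    fun b z => Finset.prod_pos fun g _ => hwpos _ _
  have hqsum : ∑ b, q b = 1 := by
    have e : ∑ b : S → α, ∑ z ∈ D, ∏ g : S, w (b g) (r z g) = D.card := by
      rw [Finset.sum_comm]
      have : ∀ z ∈ D, ∑ b : S → α, ∏ g : S, w (b g) (r z g) = 1 := by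
        intro z _
        have := Finset.prod_univ_sum (fun _ : S => (Finset.univ : Finset α))
          (fun g a => w a (r z g))
        rw [Fintype.piFinset_univ] at this
        rw [← this]
        simp [hwsum]
      rw [Finset.sum_congr rfl this]; simp
    simp only [hq, Finset.sum_add_distrib]
    rw [← Finset.mul_sum, e]
    simp only [Finset.sum_const, Finset.card_univ, Fintype.card_fun, Fintype.card_coe,
      nsmul_eq_mul, Nat.cast_pow]
    rw [← hLdef]
    field_simp; norm_num
  have hq0 : ∀ b, (2 * L ^ S.card)⁻¹ ≤ q b := by
    intro b
    have : 0 ≤ (2 * D.card : ℝ)⁻¹ * ∑ z ∈ D, ∏ g : S, w (b g) (r z g) :=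
      mul_nonneg (by positivity) (Finset.sum_nonneg fun z _ => (hprod b z).le)
    simp only [hq]; linarith
  have hqpos : ∀ b, 0 < q b := fun b => lt_of_lt_of_le (by positivity) (hq0 b)
  have hpt : ∀ x, Real.log (q fun g => p g x)⁻¹ ≤
      (Real.log 2 + Real.log D.card + S.card * Real.log (1 - θ)⁻¹) +
      (if x ∈ Uᶜ then S.card * Real.log L else 0) +
      ∑ g ∈ S, (if x ∈ W g then Real.log (L / θ) else 0) := by
    intro x
    have hWnn : 0 ≤ ∑ g ∈ S, (if x ∈ W g then Real.log (L / θ) else 0) :=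
      Finset.sum_nonneg fun g _ => by split_ifs <;> [exact hlogLθ; exact le_rfl]
    have hSθ : 0 ≤ S.card * Real.log (1 - θ)⁻¹ := by positivity
    rw [Real.log_inv]
    by_cases hx : x ∈ U
    · rw [if_neg (by simpa using hx)]
      obtain ⟨z, hz, hzr⟩ := hU x hx
      have hlow : (2 * D.card : ℝ)⁻¹ * ∏ g : S, w (p g x) (r z g) ≤ q fun g => p g x := by
        have h1 : ∏ g : S, w (p g x) (r z g) ≤ ∑ z ∈ D, ∏ g : S, w (p g x) (r z g) :=
          Finset.single_le_sum (f := fun z => ∏ g : S, w (p g x) (r z g))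
            (fun z _ => (hprod _ z).le) hz
        have h2 : 0 ≤ (2 * L ^ S.card)⁻¹ := by positivity
        have h3 : (2 * D.card : ℝ)⁻¹ * ∏ g : S, w (p g x) (r z g) ≤
          (2 * D.card : ℝ)⁻¹ * ∑ z ∈ D, ∏ g : S, w (p g x) (r z g) := by gcongr
        simp only [hq]; linarith
      have hl := Real.log_le_log (mul_pos (by positivity) (hprod _ z)) hlow
      rw [Real.log_mul (by positivity) (hprod _ z).ne', Real.log_inv, Real.log_mul two_ne_zero
        (by positivity), Real.log_prod (fun g _ => (hwpos _ _).ne')] at hl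
      have hs : ∑ g : S, -Real.log (w (p g x) (r z g)) ≤
          ∑ g ∈ S, (Real.log (1 - θ)⁻¹ + if x ∈ W g then Real.log (L / θ) else 0) := by
        rw [← Finset.sum_coe_sort S]
        refine Finset.sum_le_sum fun g _ => ?_
        rcases hzr g g.2 with h | h
        · rw [h]
          have := Real.log_le_log h1θ (hw1 (r z g))
          have h0 : (0 : ℝ) ≤ if x ∈ W g then Real.log (L / θ) else 0 := by
            split_ifs <;> [exact hlogLθ; exact le_rfl]
          rw [Real.log_inv]; linarith
        · rw [if_pos h]
          have := Real.log_le_log (by positivity) (hw0 (p g x) (r z g))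
          rw [← inv_div, Real.log_inv] at this
          linarith
      rw [Finset.sum_add_distrib, Finset.sum_const, nsmul_eq_mul, Finset.sum_neg_distrib] at hs
      linarith
    · rw [if_pos (by simpa using hx)]
      have hl := Real.log_le_log (by positivity) (hq0 fun g => p g x)
      rw [Real.log_inv, Real.log_mul two_ne_zero (by positivity), Real.log_pow] at hl
      linarith
  refine (uniformEnt_le_sum_log_inv p S q hqpos hqsum.le).trans
    ((Finset.sum_le_sum fun x _ => hpt x).trans (le_of_eq ?_))
  have hcount : ∀ (V : Set Ω) [DecidablePred (· ∈ V)] (a : ℝ),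
      ∑ x, (if x ∈ V then a else 0) = V.ncard * a := by
    intro V _ a
    rw [← Finset.sum_filter, Finset.sum_const, nsmul_eq_mul, Set.ncard_eq_toFinset_card',
      Set.toFinset_card, Fintype.card_subtype]
  rw [Finset.sum_add_distrib, Finset.sum_add_distrib, hcount, Finset.sum_comm]
  simp only [hcount, Finset.sum_const, Finset.card_univ, nsmul_eq_mul, Finset.sum_mul]

end Coding

section Tiling

variable {α : Type*} [Group G] [DecidableEq G]

/-- The number of pairs `(x, c) ∈ E × F` with `c x ∈ V`. -/
noncomputable def visitCount (act : G → X → X) (E : Finset X) (F : Finset G) (V : Set X) : ℕ :=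
  ∑ c ∈ F, {x : E | act c x ∈ V}.ncard

theorem ncard_coe_finset_le (E : Finset X) (V : Set E) : V.ncard ≤ E.card := by
  have := Set.ncard_le_ncard (Set.subset_univ V)
  simpa [Set.ncard_univ] using this

theorem sum_translate_le (act : G → X → X) (E : Finset X) (F : Finset G) (V : Set X) (t : G) :
    ∑ c ∈ F, {x : E | act (t * c) x ∈ V}.ncard ≤
      visitCount act E F V + ((F.image fun h => t * h) \ F).card * E.card := by
  have h : ∑ c ∈ F, {x : E | act (t * c) x ∈ V}.ncard =
      ∑ c ∈ F.image fun h => t * h, {x : E | act c x ∈ V}.ncard := by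
    rw [Finset.sum_image fun a _ b _ h => mul_left_cancel h]
  rw [h, ← Finset.sum_inter_add_sum_sdiff _ F]
  refine add_le_add (Finset.sum_le_sum_of_subset Finset.inter_subset_right) ?_
  rw [← smul_eq_mul, ← Finset.sum_const]
  exact Finset.sum_le_sum fun c _ => ncard_coe_finset_le E _

theorem le_card_filter_mem_translate (F T : Finset G) (g : G) (hg : g ∈ F) :
    T.card ≤ ((T.biUnion fun t => F.image fun h => t⁻¹ * h).filter
      fun c => g ∈ T.image fun t => t * c).card := by
  rw [← Finset.card_image_of_injective T
    (f := fun t => t⁻¹ * g) fun a b h => by simpa using h]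
  refine Finset.card_le_card fun c hc => ?_
  obtain ⟨t, ht, rfl⟩ := Finset.mem_image.1 hc
  refine Finset.mem_filter.2 ⟨Finset.mem_biUnion.2 ⟨t, ht, Finset.mem_image_of_mem _ hg⟩,
    Finset.mem_image.2 ⟨t, ht, by simp⟩⟩

theorem card_mul_log_card_le [Fintype α] [Nonempty α] (act : G → X → X)
    (hmul : ∀ g h x, act (g * h) x = act g (act h x))
    (E : Finset X) (P : X → α) (F T : Finset G)
    (hinj : ∀ x ∈ E, ∀ y ∈ E, (∀ g ∈ F, P (act g x) = P (act g y)) → x = y)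
    (D : Finset X) (hD : D.Nonempty) (U W : Set X)
    (hU : ∀ y ∈ U, ∃ z ∈ D, ∀ t ∈ T, P (act t y) = P (act t z) ∨ act t y ∈ W)
    {θ : ℝ} (hθ : 0 < θ) (hθ1 : θ < 1) :
    T.card * (E.card * Real.log E.card) ≤
      F.card * (E.card * (Real.log 2 + Real.log D.card + T.card * Real.log (1 - θ)⁻¹)) +
      visitCount act E F Uᶜ * (T.card * Real.log (Fintype.card α)) +
      (T.card * visitCount act E F W +
        (∑ t ∈ T, (((F.image fun h => t * h) \ F).card : ℝ)) * E.card) *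
          Real.log (Fintype.card α / θ) +
      (∑ t ∈ T, (((F.image fun h => t⁻¹ * h) \ F).card : ℝ)) *
        (E.card * (T.card * Real.log (Fintype.card α))) := by
  classical
  have hL : (1 : ℝ) ≤ Fintype.card α := by exact_mod_cast Fintype.card_pos
  have hlogL : 0 ≤ Real.log (Fintype.card α) := Real.log_nonneg hL
  have hlogLθ : 0 ≤ Real.log (Fintype.card α / θ) :=
    Real.log_nonneg (by rw [le_div_iff₀ hθ]; linarith)
  set p : G → E → α := fun g x => P (act g x) with hp
  set C := T.biUnion fun t => F.image fun h => t⁻¹ * h with hC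
  set S : G → Finset G := fun c => T.image fun t => t * c with hS
  have hScard : ∀ c, (S c).card = T.card := fun c =>
    Finset.card_image_of_injective T fun a b h => by simpa using h
  have hfull : uniformEnt p F = E.card * Real.log E.card := by
    have : ∀ x : E, (cylinder p F x).card = 1 := by
      intro x
      rw [Finset.card_eq_one]
      refine ⟨x, Finset.eq_singleton_iff_unique_mem.2 ⟨mem_cylinder.2 fun _ _ => rfl, ?_⟩⟩
      intro y hy
      exact Subtype.ext (hinj y y.2 x x.2 (mem_cylinder.1 hy))
    simp [uniformEnt, this]
  have hshear := mul_uniformEnt_le_sum p C S T.card F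
    fun g hg => le_card_filter_mem_translate F T g hg
  rw [hfull] at hshear
  have hCsplit : ∑ c ∈ C, uniformEnt p (S c) ≤
      ∑ c ∈ F, uniformEnt p (S c) + ∑ c ∈ C \ F, uniformEnt p (S c) := by
    have hnn : ∀ c, 0 ≤ uniformEnt p (S c) := fun c => by
      rw [← uniformEnt_empty p]; exact uniformEnt_mono p (Finset.empty_subset _)
    rw [← Finset.sum_inter_add_sum_sdiff C F]
    refine add_le_add (Finset.sum_le_sum_of_subset_of_nonneg Finset.inter_subset_right
      fun c _ _ => hnn c) le_rfl
  have hbdry : ∑ c ∈ C \ F, uniformEnt p (S c) ≤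
      (∑ t ∈ T, (((F.image fun h => t⁻¹ * h) \ F).card : ℝ)) *
        (E.card * (T.card * Real.log (Fintype.card α))) := by
    have h1 : ((C \ F).card : ℝ) ≤ ∑ t ∈ T, (((F.image fun h => t⁻¹ * h) \ F).card : ℝ) := by
      have : C \ F = T.biUnion fun t => (F.image fun h => t⁻¹ * h) \ F := by
        ext a; simp only [hC, Finset.mem_sdiff, Finset.mem_biUnion]; tauto
      rw [this]
      exact_mod_cast Finset.card_biUnion_le
    calc _ ≤ ∑ c ∈ C \ F, (E.card * (T.card * Real.log (Fintype.card α)) : ℝ) := by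
          refine Finset.sum_le_sum fun c _ => ?_
          have := uniformEnt_le_card_mul p (S c)
          rwa [hScard, Fintype.card_coe] at this
      _ ≤ _ := by
          rw [Finset.sum_const, nsmul_eq_mul]
          gcongr
  have hint : ∀ c ∈ F, uniformEnt p (S c) ≤
      E.card * (Real.log 2 + Real.log D.card + T.card * Real.log (1 - θ)⁻¹) +
      ({x : E | act c x ∈ Uᶜ}.ncard : ℝ) * (T.card * Real.log (Fintype.card α)) +
      (∑ t ∈ T, ({x : E | act (t * c) x ∈ W}.ncard : ℝ)) *
        Real.log (Fintype.card α / θ) := by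
    intro c _
    have := uniformEnt_le_of_words p (S c) D hD (fun z g => P (act (g * c⁻¹) z))
      {x : E | act c x ∈ U} (fun g => {x : E | act g x ∈ W}) ?_ hθ hθ1
    · rw [hScard, Fintype.card_coe, Finset.sum_image fun a _ b _ h => mul_right_cancel h] at this
      exact this
    · intro x hx
      obtain ⟨z, hz, h⟩ := hU _ hx
      refine ⟨z, hz, fun g hg => ?_⟩
      obtain ⟨t, ht, rfl⟩ := Finset.mem_image.1 hg
      simpa [hp, hmul, mul_inv_cancel_right] using h t ht
  have hW : ∑ c ∈ F, ∑ t ∈ T, ({x : E | act (t * c) x ∈ W}.ncard : ℝ) ≤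
      T.card * visitCount act E F W +
        (∑ t ∈ T, (((F.image fun h => t * h) \ F).card : ℝ)) * E.card := by
    rw [Finset.sum_comm, Finset.sum_mul, ← nsmul_eq_mul, ← Finset.sum_const,
      ← Finset.sum_add_distrib]
    exact Finset.sum_le_sum fun t _ => by exact_mod_cast sum_translate_le act E F W t
  have hF := Finset.sum_le_sum hint
  rw [Finset.sum_add_distrib, Finset.sum_add_distrib, Finset.sum_const, nsmul_eq_mul,
    ← Finset.sum_mul, ← Finset.sum_mul] at hF
  have hWm := mul_le_mul_of_nonneg_right hW hlogLθ
  have hv : ∑ c ∈ F, ({x : E | act c x ∈ Uᶜ}.ncard : ℝ) = visitCount act E F Uᶜ := by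
    simp [visitCount]
  rw [hv] at hF
  linarith

end Tiling

section Limit

theorem exists_empirical_measure [MeasurableSpace X] (act : G → X → X) (E : Finset X) (F : Finset G)
    (hE : E.Nonempty) (hF : F.Nonempty) :
    ∃ ν : ProbabilityMeasure X, ∀ V : Set X, MeasurableSet V →
      (ν : Measure X) V = ENNReal.ofReal (visitCount act E F V / (E.card * F.card)) := by
  classical
  have hEc : (0 : ℝ) < E.card := by exact_mod_cast hE.card_pos
  have hFc : (0 : ℝ) < F.card := by exact_mod_cast hF.card_pos
  set ν : Measure X := ENNReal.ofReal (E.card * F.card)⁻¹ •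
    ∑ c ∈ F, ∑ x : E, Measure.dirac (act c x) with hν
  have hval : ∀ V : Set X, MeasurableSet V →
      ν V = ENNReal.ofReal (visitCount act E F V / (E.card * F.card)) := by
    intro V hV
    have h : (∑ c ∈ F, ∑ x : E, Measure.dirac (act c x)) V =
        ENNReal.ofReal (visitCount act E F V) := by
      rw [ENNReal.ofReal_natCast, Measure.finsetSum_apply, visitCount, Nat.cast_sum]
      refine Finset.sum_congr rfl fun c _ => ?_
      rw [Measure.finsetSum_apply]
      simp only [Measure.dirac_apply' _ hV, Set.indicator_apply, Pi.one_apply]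
      rw [← Finset.sum_filter, Finset.sum_const, nsmul_eq_mul, mul_one,
        Set.ncard_eq_toFinset_card', Set.toFinset_card, Fintype.card_subtype]
      rfl
    rw [hν, Measure.smul_apply, h, smul_eq_mul, ← ENNReal.ofReal_mul (by positivity),
      inv_mul_eq_div]
  refine ⟨⟨ν, ⟨?_⟩⟩, hval⟩
  rw [hval _ MeasurableSet.univ]
  have : (visitCount act E F Set.univ : ℝ) = E.card * F.card := by
    simp [visitCount, Set.ncard_univ, mul_comm]
  rw [this, div_self (by positivity), ENNReal.ofReal_one]

variable [MetricSpace X] [CompactSpace X] [MeasurableSpace X] [BorelSpace X]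

theorem exists_limit_measure (act : G → X → X) (E : ℕ → Finset X) (Fs : ℕ → Finset G)
    (hE : ∀ n, (E n).Nonempty) (hF : ∀ n, (Fs n).Nonempty) (l : Ultrafilter ℕ) :
    ∃ μ : ProbabilityMeasure X, ∀ (V : Set X) (r : ℝ), IsClosed V →
      (μ : Measure X) V < ENNReal.ofReal r →
      ∀ᶠ n in (l : Filter ℕ), (visitCount act (E n) (Fs n) V : ℝ) ≤
        r * ((E n).card * (Fs n).card) := by
  choose ν hν using fun n => exists_empirical_measure act (E n) (Fs n) (hE n) (hF n)
  have hcpt : IsCompact (Set.univ : Set (ProbabilityMeasure X)) := by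
    simpa using isCompact_closure_of_isTightMeasureSet
      (S := (Set.univ : Set (ProbabilityMeasure X)))
      IsTightMeasureSet.of_compactSpace
  obtain ⟨μ, -, hμ⟩ := hcpt.ultrafilter_le_nhds' (l.map ν) Filter.univ_mem
  refine ⟨μ, fun V r hV hr => ?_⟩
  have hlim : Tendsto ν l (𝓝 μ) := hμ
  have h := lt_of_le_of_lt (ProbabilityMeasure.limsup_measure_closed_le_of_tendsto hlim hV) hr
  filter_upwards [Filter.eventually_lt_of_limsup_lt h] with n hn
  have hEc : (0 : ℝ) < (E n).card := by exact_mod_cast (hE n).card_pos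
  have hFc : (0 : ℝ) < (Fs n).card := by exact_mod_cast (hF n).card_pos
  rw [hν n V hV.measurableSet] at hn
  have := (ENNReal.ofReal_lt_ofReal_iff_of_nonneg (by positivity)).1 hn
  rw [div_lt_iff₀ (by positivity)] at this
  exact this.le

/-- A finite partition into sets of small diameter which is locally constant outside of closed
sets of arbitrarily small measure. -/
theorem exists_partition (μ : Measure X) [IsFiniteMeasure μ] {ε : ℝ} (hε : 0 < ε) :
    ∃ (s : Finset X) (P : X → s → Bool), (∀ x y, P x = P y → dist x y ≤ ε) ∧
      ∀ η : ℝ, 0 < η → ∃ (γ : ℝ) (W : Set X), 0 < γ ∧ IsClosed W ∧ μ W < ENNReal.ofReal η ∧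
        ∀ x y, dist x y ≤ γ → x ∉ W → P x = P y := by
  classical
  have hr : ∀ x : X, ∃ r ∈ Set.Ioo 0 (ε / 2), μ {y | dist y x = r} = 0 := by
    intro x
    have hc : Set.Countable {t : ℝ | 0 < μ {y | dist y x = t}} :=
      Measure.countable_meas_level_set_pos₀
        (by fun_prop : Measurable fun y => dist y x).nullMeasurable
    by_contra! hcon
    have : Set.Ioo 0 (ε / 2) ⊆ {t : ℝ | 0 < μ {y | dist y x = t}} :=
      fun r hr => pos_iff_ne_zero.2 (hcon r hr)
    have := hc.mono this
    rw [← Cardinal.le_aleph0_iff_set_countable, Cardinal.mk_Ioo_real (by positivity)] at this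
    exact absurd this (not_le.2 Cardinal.aleph0_lt_continuum)
  choose r hr0 hr1 using hr
  obtain ⟨s, -, hs⟩ := isCompact_univ.elim_nhds_subcover (fun x : X => Metric.ball x (r x))
    fun x _ => Metric.ball_mem_nhds x (hr0 x).1
  refine ⟨s, fun y i => decide (dist y i < r i), fun x y hxy => ?_, fun η hη => ?_⟩
  · obtain ⟨i, hi, hxi⟩ := Set.mem_iUnion₂.1 (hs (Set.mem_univ x))
    have h := congrFun hxy ⟨i, hi⟩
    have hxi : dist x i < r i := hxi
    have hyi : dist y i < r i := by simpa [hxi] using h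
    have := dist_triangle_right x y i
    have := (hr0 i).2
    linarith
  · set A : X → ℕ → Set X := fun i n => {y | |dist y i - r i| ≤ 1 / ((n : ℝ) + 1)} with hA
    have hAc : ∀ i n, IsClosed (A i n) := fun i n =>
      isClosed_le (by fun_prop) continuous_const
    have hAt : ∀ i, Tendsto (fun n => μ (A i n)) atTop (𝓝 0) := by
      intro i
      have hanti : Antitone (A i) := fun m n hmn y hy =>
        le_trans (show |dist y i - r i| ≤ _ from hy) (Nat.one_div_le_one_div hmn)
      have h := tendsto_measure_iInter_atTop (μ := μ)
        (fun n => (hAc i n).measurableSet.nullMeasurableSet) hanti ⟨0, measure_ne_top _ _⟩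
      have hI : μ (⋂ n, A i n) = 0 := by
        refine measure_mono_null (fun y hy => ?_) (hr1 i)
        have hy : ∀ n : ℕ, |dist y i - r i| ≤ 1 / ((n : ℝ) + 1) := Set.mem_iInter.1 hy
        have h0 := ge_of_tendsto' tendsto_one_div_add_atTop_nhds_zero_nat hy
        exact sub_eq_zero.1 (abs_eq_zero.1 (le_antisymm h0 (abs_nonneg _)))
      rwa [hI] at h
    have hsum : Tendsto (fun n => ∑ i ∈ s, μ (A i n)) atTop (𝓝 0) := by
      simpa using tendsto_finsetSum s fun i _ => hAt i
    obtain ⟨n, hn⟩ := (hsum.eventually_lt_const (ENNReal.ofReal_pos.2 hη)).exists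
    refine ⟨1 / ((n : ℝ) + 1), ⋃ i ∈ s, A i n, by positivity,
      s.finite_toSet.isClosed_biUnion fun i _ => hAc i n,
      lt_of_le_of_lt (measure_biUnion_finset_le s _) hn, fun x y hxy hx => ?_⟩
    funext i
    have hxi : ¬ |dist x i - r i| ≤ 1 / ((n : ℝ) + 1) :=
      fun h => hx (Set.mem_iUnion₂.2 ⟨i, i.2, h⟩)
    have h2 := (abs_le.1 ((abs_dist_sub_le x y (i : X)).trans hxy))
    rw [abs_le, not_and_or, not_le, not_le] at hxi
    rw [decide_eq_decide]
    constructor <;> intro h <;> rcases hxi with h' | h' <;> linarith [h2.1, h2.2]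

end Limit

section Packing

theorem card_mul_le_packP [PseudoMetricSpace X] (act : G → X → X) (Fs : ℕ → Finset G) {Z : Set X}
    {N n : ℕ} (hn : N ≤ n) (ε s : ℝ) (D : Finset X) (hDZ : ↑D ⊆ Z)
    (hD : ∀ x ∈ D, ∀ y ∈ D, x ≠ y →
      Disjoint (dynClosedBall act (Fs n) x ε) (dynClosedBall act (Fs n) y ε)) :
    (D.card : ℝ≥0∞) * ENNReal.ofReal (Real.exp (-s * (Fs n).card)) ≤ packP act Fs Z N ε s := by
  rcases D.eq_empty_or_nonempty with rfl | ⟨x₀, -⟩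
  · simp
  set c : ℕ → X × ℕ := fun i => (D.toList.getD i x₀, n) with hc
  have hmem : ∀ i ∈ (Finset.range D.card : Set ℕ), ∃ h : i < D.toList.length,
      (c i).1 = D.toList[i] := by
    intro i hi
    have h : i < D.toList.length := by simpa using hi
    exact ⟨h, by simp [hc, List.getElem?_eq_getElem h]⟩
  have hin : ∀ i ∈ (Finset.range D.card : Set ℕ), (c i).1 ∈ D := by
    intro i hi
    obtain ⟨h, e⟩ := hmem i hi
    rw [e, ← Finset.mem_toList]
    exact List.getElem_mem h
  have hle : ∑' i : (Finset.range D.card : Set ℕ),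
      ENNReal.ofReal (Real.exp (-s * ((Fs (c (i : ℕ)).2).card : ℝ))) ≤ packP act Fs Z N ε s := by
    refine le_iSup₂_of_le (Finset.range D.card : Set ℕ) c (le_iSup₂_of_le
      (fun i hi => ⟨hDZ (hin i hi), hn⟩) (fun i hi j hj hij => ?_) le_rfl)
    refine hD _ (hin i hi) _ (hin j hj) fun h => hij ?_
    obtain ⟨hi', ei⟩ := hmem i hi
    obtain ⟨hj', ej⟩ := hmem j hj
    rw [ei, ej] at h
    exact (List.Nodup.getElem_inj_iff D.nodup_toList).1 h
  refine le_trans (le_of_eq ?_) hle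
  rw [Finset.tsum_subtype' (Finset.range D.card)
    fun i => ENNReal.ofReal (Real.exp (-s * ((Fs (c i).2).card : ℝ)))]
  simp [hc]

/-- A maximal family of disjoint closed Bowen balls centered in `Z` yields a spanning set. -/
theorem exists_spanning_of_packP_lt_one [PseudoMetricSpace X] (act : G → X → X)
    (Fs : ℕ → Finset G) {Z : Set X} {N n : ℕ} (hn : N ≤ n) {ε s : ℝ} (hε : 0 < ε)
    (h : packP act Fs Z N ε s < 1) :
    ∃ D : Finset X, (D.card : ℝ) ≤ Real.exp (s * (Fs n).card) ∧
      ∀ x ∈ Z, ∃ z ∈ D, ∀ g ∈ Fs n, dist (act g x) (act g z) ≤ 2 * ε := by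
  classical
  set A : Set ℕ := {k | ∃ D : Finset X, ↑D ⊆ Z ∧ (∀ x ∈ D, ∀ y ∈ D, x ≠ y →
      Disjoint (dynClosedBall act (Fs n) x ε) (dynClosedBall act (Fs n) y ε)) ∧ D.card = k} with hA
  have hbd : ∀ k ∈ A, (k : ℝ) ≤ Real.exp (s * (Fs n).card) := by
    rintro k ⟨D, hDZ, hD, rfl⟩
    have := (card_mul_le_packP act Fs hn ε s D hDZ hD).trans h.le
    rw [← ENNReal.ofReal_natCast, ← ENNReal.ofReal_mul (by positivity), ENNReal.ofReal_le_one,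
      neg_mul, Real.exp_neg, ← div_eq_mul_inv, div_le_one (Real.exp_pos _)] at this
    exact this
  have hbdd : BddAbove A :=
    ⟨⌊Real.exp (s * (Fs n).card)⌋₊, fun k hk => Nat.le_floor (hbd k hk)⟩
  have hmem : sSup A ∈ A := Nat.sSup_mem ⟨0, ∅, by simp⟩ hbdd
  obtain ⟨D, hDZ, hD, hDc⟩ := id hmem
  refine ⟨D, hDc ▸ hbd _ hmem, fun x hx => ?_⟩
  by_contra! hcon
  have hself : ∀ g ∈ Fs n, dist (act g x) (act g x) ≤ 2 * ε := fun g _ => by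
    rw [dist_self]; positivity
  have hxD : x ∉ D := fun hxD => by
    obtain ⟨g, hg, h⟩ := hcon x hxD
    exact absurd (hself g hg) (not_le.2 h)
  have hdisj : ∀ z ∈ D, Disjoint (dynClosedBall act (Fs n) x ε) (dynClosedBall act (Fs n) z ε) := by
    intro z hz
    rw [Set.disjoint_left]
    intro w hw1 hw2
    obtain ⟨g, hg, h⟩ := hcon z hz
    have h1 : dist (act g x) (act g w) ≤ ε := hw1 g hg
    have h2 : dist (act g z) (act g w) ≤ ε := hw2 g hg
    have := dist_triangle_right (act g x) (act g z) (act g w)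
    linarith
  have : D.card + 1 ∈ A := by
    refine ⟨insert x D, ?_, ?_, Finset.card_insert_of_notMem hxD⟩
    · rw [Finset.coe_insert]; exact Set.insert_subset hx hDZ
    · intro a ha b hb hab
      rcases Finset.mem_insert.1 ha with ha' | ha' <;> rcases Finset.mem_insert.1 hb with hb' | hb'
      · exact absurd (ha'.trans hb'.symm) hab
      · exact ha' ▸ hdisj b hb'
      · exact hb' ▸ (hdisj a ha').symm
      · exact hD a ha' b hb' hab
  have := le_csSup hbdd this
  omega

theorem isOpen_dynBall [PseudoMetricSpace X] (act : G → X → X) (hact : ∀ g, Continuous (act g))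
    (F : Finset G) (x : X) (ε : ℝ) : IsOpen (dynBall act F x ε) := by
  have : dynBall act F x ε = ⋂ g ∈ F, {y | dist (act g x) (act g y) < ε} := by
    ext; simp [dynBall]
  rw [this]
  refine isOpen_biInter_finset fun g _ => ?_
  have := hact g
  exact isOpen_lt (by fun_prop) continuous_const

theorem bddAbove_card_dynSeparated [PseudoMetricSpace X] [CompactSpace X] (act : G → X → X)
    (hact : ∀ g, Continuous (act g)) (F : Finset G) (Z : Set X) {ε : ℝ} (hε : 0 < ε) :
    BddAbove {k : ℕ | ∃ E : Finset X, ↑E ⊆ Z ∧ IsDynSeparated act F ε ↑E ∧ E.card = k} := by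
  have hopen : ∀ x, dynBall act F x (ε / 2) ∈ 𝓝 x := fun x =>
    (isOpen_dynBall act hact F x _).mem_nhds fun g _ => by rw [dist_self]; positivity
  obtain ⟨s, -, hs⟩ := isCompact_univ.elim_nhds_subcover _ fun x _ => hopen x
  refine ⟨s.card, ?_⟩
  rintro k ⟨E, -, hE, rfl⟩
  have : ∀ x : X, ∃ z ∈ s, x ∈ dynBall act F z (ε / 2) := fun x => by
    simpa using hs (Set.mem_univ x)
  choose f hf hfx using this
  refine Finset.card_le_card_of_injOn f (fun x _ => hf x) fun x hx y hy hxy => ?_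
  by_contra hne
  obtain ⟨g, hg, h⟩ := hE x hx y hy hne
  have h1 : dist (act g (f x)) (act g x) < ε / 2 := hfx x g hg
  have h2 : dist (act g (f x)) (act g y) < ε / 2 := hxy ▸ hfx y g hg
  have := dist_triangle_left (act g x) (act g y) (act g (f x))
  linarith

theorem card_le_sepNum [PseudoMetricSpace X] [CompactSpace X] (act : G → X → X)
    (hact : ∀ g, Continuous (act g)) (F : Finset G) {ε : ℝ} (hε : 0 < ε) (E : Finset X)
    (hE : IsDynSeparated act F ε ↑E) : E.card ≤ sepNum act F Set.univ ε :=
  le_csSup (bddAbove_card_dynSeparated act hact F _ hε) ⟨E, Set.subset_univ _, hE, rfl⟩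

theorem exists_card_eq_sepNum [PseudoMetricSpace X] [CompactSpace X] (act : G → X → X)
    (hact : ∀ g, Continuous (act g)) (F : Finset G) {ε : ℝ} (hε : 0 < ε) :
    ∃ E : Finset X, IsDynSeparated act F ε ↑E ∧ E.card = sepNum act F Set.univ ε := by
  have h := Nat.sSup_mem (s := {k : ℕ | ∃ E : Finset X, ↑E ⊆ (Set.univ : Set X) ∧
    IsDynSeparated act F ε ↑E ∧ E.card = k}) ⟨0, ∅, by simp [IsDynSeparated]⟩
    (bddAbove_card_dynSeparated act hact F _ hε)
  obtain ⟨E, -, h1, h2⟩ := h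
  exact ⟨E, h1, h2⟩

theorem sepNum_pos [PseudoMetricSpace X] [CompactSpace X] [Nonempty X] (act : G → X → X)
    (hact : ∀ g, Continuous (act g)) (F : Finset G) {ε : ℝ} (hε : 0 < ε) :
    0 < sepNum act F (Set.univ : Set X) ε := by
  have h := card_le_sepNum act hact F hε {Classical.arbitrary X}
    (by intro x hx y hy hxy; simp at hx hy; exact absurd (hx.trans hy.symm) hxy)
  rw [Finset.card_singleton] at h
  exact h

theorem packP_univ_le_tsum [PseudoMetricSpace X] [CompactSpace X] (act : G → X → X)
    (hact : ∀ g, Continuous (act g)) (Fs : ℕ → Finset G) (N : ℕ) {ε : ℝ} (hε : 0 < ε) (s : ℝ) :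
    packP act Fs (Set.univ : Set X) N ε s ≤
      ∑' k, (sepNum act (Fs (k + N)) (Set.univ : Set X) ε : ℝ≥0∞) *
        ENNReal.ofReal (Real.exp (-s * (Fs (k + N)).card)) := by
  classical
  refine iSup₂_le fun t c => iSup₂_le fun hN hdisj => ?_
  set a : ℕ → ℝ≥0∞ := fun n => ENNReal.ofReal (Real.exp (-s * (Fs n).card)) with ha
  have hsplit : ∀ i : t, a (c i).2 = ∑' k, if (c i).2 = k + N then a (k + N) else 0 := by
    intro i
    have hi := (hN i i.2).2
    rw [tsum_eq_single ((c i).2 - N)]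
    · rw [if_pos (by omega), Nat.sub_add_cancel hi]
    · intro k hk
      exact if_neg fun h => hk (by omega)
  calc _ = ∑' i : t, ∑' k, (if (c i).2 = k + N then a (k + N) else 0) := tsum_congr hsplit
    _ = ∑' k, ∑' i : t, (if (c i).2 = k + N then a (k + N) else 0) := ENNReal.tsum_comm
    _ ≤ _ := ENNReal.tsum_le_tsum fun k => ?_
  rw [ENNReal.tsum_eq_iSup_sum]
  refine iSup_le fun u => ?_
  rw [← Finset.sum_filter, Finset.sum_const, nsmul_eq_mul]
  refine mul_le_mul_left ?_ _
  norm_cast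
  have hself : ∀ n x, x ∈ dynClosedBall act (Fs n) x ε := fun n x g _ => by
    rw [dist_self]; exact hε.le
  have hinj : Set.InjOn (fun i : t => (c i).1)
      (u.filter fun i : t => (c i).2 = k + N : Finset t) := by
    intro i hi j hj hij
    by_contra hne
    have h := hdisj i i.2 j j.2 fun h => hne (Subtype.ext h)
    have hij : (c i).1 = (c j).1 := hij
    rw [hij] at h
    exact Set.disjoint_left.1 h (hself _ _) (hself _ _)
  rw [← Finset.card_image_of_injOn hinj]
  refine card_le_sepNum act hact _ hε _ ?_
  intro x hx y hy hxy
  simp only [Finset.coe_image, Set.mem_image, Finset.mem_coe, Finset.mem_filter] at hx hy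
  obtain ⟨i, ⟨-, hi⟩, rfl⟩ := hx
  obtain ⟨j, ⟨-, hj⟩, rfl⟩ := hy
  have h := hdisj i i.2 j j.2 fun h => hxy (by rw [h])
  rw [hi, hj] at h
  by_contra! hcon
  exact Set.disjoint_left.1 h (fun g hg => hcon g hg) (hself _ _)

end Packing

section UpperBound

theorem eventually_mul_log_le_card [Group G] {Fs : ℕ → Finset G} (h : GrowthCond Fs) (C : ℝ) :
    ∀ᶠ n : ℕ in atTop, C * Real.log n ≤ (Fs n).card := by
  filter_upwards [h.eventually_ge_atTop C, eventually_gt_atTop 1] with n hn h1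
  have : 0 < Real.log n := Real.log_pos (by exact_mod_cast h1)
  exact (le_div_iff₀ this).1 hn

theorem GrowthCond.tendsto_card [Group G] {Fs : ℕ → Finset G} (h : GrowthCond Fs) :
    Tendsto (fun n => ((Fs n).card : ℝ)) atTop atTop := by
  refine tendsto_atTop_mono' _ (eventually_mul_log_le_card h 1) ?_
  simpa [Function.comp_def] using Real.tendsto_log_atTop.comp tendsto_natCast_atTop_atTop

theorem summable_exp_neg_mul_card [Group G] {Fs : ℕ → Finset G} (h : GrowthCond Fs) {c : ℝ}
    (hc : 0 < c) : Summable fun n => Real.exp (-c * (Fs n).card) := by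
  refine Summable.of_norm_bounded_eventually_nat (Real.summable_one_div_nat_pow.2 one_lt_two) ?_
  filter_upwards [eventually_mul_log_le_card h (2 / c), eventually_gt_atTop 0] with n hn h0
  have h0' : (0 : ℝ) < n := by exact_mod_cast h0
  rw [Real.norm_of_nonneg (Real.exp_pos _).le,
    ← Real.exp_log (show (0 : ℝ) < 1 / n ^ 2 by positivity),
    Real.exp_le_exp, one_div, Real.log_inv, Real.log_pow]
  have := mul_le_mul_of_nonneg_left hn hc.le
  have e : c * (2 / c * Real.log n) = 2 * Real.log n := by field_simp
  push_cast
  linarith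

theorem packEntEps_univ_le_ucEntEps [Group G] [PseudoMetricSpace X] [CompactSpace X]
    (act : G → X → X) (hact : ∀ g, Continuous (act g)) {Fs : ℕ → Finset G}
    (hne : ∀ n, (Fs n).Nonempty) (hgrow : GrowthCond Fs) {ε : ℝ} (hε : 0 < ε) :
    packEntEps act Fs (Set.univ : Set X) ε ≤ ucEntEps act Fs (Set.univ : Set X) ε := by
  refine le_of_forall_gt fun b hb => ?_
  obtain ⟨r, hr, hrb⟩ := ENNReal.lt_iff_exists_nnreal_btwn.1 hb
  obtain ⟨s, hrs, hsb⟩ := ENNReal.lt_iff_exists_nnreal_btwn.1 hrb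
  refine lt_of_le_of_lt (iInf₂_le s ?_) hsb
  have hrs' : (0 : ℝ) < s - r := sub_pos.2 (by exact_mod_cast hrs)
  have hsep : ∀ᶠ n in atTop,
      (sepNum act (Fs n) (Set.univ : Set X) ε : ℝ) ≤ Real.exp (r * (Fs n).card) := by
    filter_upwards [eventually_lt_of_limsup_lt hr] with n hn
    rcases Nat.eq_zero_or_pos (sepNum act (Fs n) (Set.univ : Set X) ε) with h0 | h0
    · rw [h0, Nat.cast_zero]; positivity
    have hc : (0 : ℝ) < (Fs n).card := by exact_mod_cast (hne n).card_pos
    rw [← Real.log_le_iff_le_exp (by exact_mod_cast h0), ← div_le_iff₀ hc]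
    rw [← ENNReal.ofReal_coe_nnreal] at hn
    exact (ENNReal.ofReal_le_ofReal_iff r.2).1 hn.le
  obtain ⟨M, hM⟩ := eventually_atTop.1 hsep
  have hsum : ∑' n, ENNReal.ofReal (Real.exp (-(s - r : ℝ) * (Fs n).card)) ≠ ⊤ :=
    (summable_exp_neg_mul_card hgrow hrs').tsum_ofReal_ne_top
  have hzero : packPLim act Fs (Set.univ : Set X) ε s = 0 := by
    refine le_antisymm ?_ zero_le
    refine ge_of_tendsto (ENNReal.tendsto_sum_nat_add _ hsum) ?_
    filter_upwards [eventually_ge_atTop M] with N hN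
    refine (iInf_le _ N).trans ((packP_univ_le_tsum act hact Fs N hε s).trans ?_)
    refine ENNReal.tsum_le_tsum fun k => ?_
    rw [← ENNReal.ofReal_natCast, ← ENNReal.ofReal_mul (by positivity)]
    refine ENNReal.ofReal_le_ofReal ?_
    refine (mul_le_mul_of_nonneg_right (hM (k + N) (by omega)) (Real.exp_pos _).le).trans ?_
    rw [← Real.exp_add]
    exact Real.exp_le_exp.2 (by ring_nf; rfl)
  refine le_antisymm ((iInf₂_le (fun _ => Set.univ)
    (Set.subset_iUnion (fun _ : ℕ => Set.univ) 0)).trans ?_) zero_le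
  simp [hzero]

end UpperBound

section LowerBound

theorem Folner.eventually_sum_card_sdiff_le [Group G] [DecidableEq G] {Fs : ℕ → Finset G}
    (hF : Folner Fs) (T : Finset G) (φ : G → G) {η : ℝ} (hη : 0 < η) :
    ∀ᶠ n in atTop, ∑ t ∈ T, ((((Fs n).image fun h => φ t * h) \ Fs n).card : ℝ) ≤
      η * (Fs n).card := by
  have h := tendsto_finsetSum T fun t _ => hF.2 (φ t)
  rw [Finset.sum_const_zero] at h
  filter_upwards [h.eventually_lt_const hη] with n hn
  have hc : (0 : ℝ) < (Fs n).card := by exact_mod_cast (hF.1 n).card_pos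
  rw [← Finset.sum_div, div_lt_iff₀ hc] at hn
  refine le_trans (Finset.sum_le_sum fun t _ => ?_) hn.le
  exact_mod_cast Finset.card_le_card (by
    rw [symmDiff_def]; exact Finset.subset_union_left)

/-- If `X` is covered by countably many sets of small packing pre-measure, then some window
`Fs m` admits a small set spanning an open set of nearly full measure. -/
theorem exists_spanning_of_cover [Group G] [PseudoMetricSpace X] [Nonempty X] [MeasurableSpace X]
    [BorelSpace X] (act : G → X → X) (hact : ∀ g, Continuous (act g)) {Fs : ℕ → Finset G}
    (hgrow : GrowthCond Fs) (μ : Measure X) [IsProbabilityMeasure μ] {s δ η κ : ℝ} (hs : 0 ≤ s)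
    (hδ : 0 < δ) (hη : 0 < η) (hκ : 0 < κ) (Zs : ℕ → Set X) (hZ : Set.univ ⊆ ⋃ i, Zs i)
    (hZs : ∀ i, ∃ N, packP act Fs (Zs i) N δ s < 1) :
    ∃ (m : ℕ) (D : Finset X) (U : Set X), D.Nonempty ∧ IsOpen U ∧ μ Uᶜ < ENNReal.ofReal η ∧
      (∀ y ∈ U, ∃ z ∈ D, ∀ t ∈ Fs m, dist (act t y) (act t z) ≤ 3 * δ) ∧
      Real.log 2 + Real.log D.card ≤ (s + κ) * (Fs m).card := by
  classical
  choose N hN using hZs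
  set Y : ℕ → Set X := fun j => ⋃ i < j, Zs i with hY
  have hYm : Monotone Y := fun a b hab =>
    Set.biUnion_subset_biUnion_left fun i hi => lt_of_lt_of_le hi hab
  have hYu : ⋃ j, Y j = Set.univ := Set.eq_univ_of_univ_subset fun x hx => by
    obtain ⟨i, hi⟩ := Set.mem_iUnion.1 (hZ hx)
    exact Set.mem_iUnion.2 ⟨i + 1, Set.mem_biUnion (Nat.lt_succ_self i) hi⟩
  have htend := tendsto_measure_iUnion_atTop (μ := μ) hYm
  rw [hYu, measure_univ] at htend
  have hlt : 1 - ENNReal.ofReal η < 1 :=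
    ENNReal.sub_lt_self ENNReal.one_ne_top one_ne_zero (by simpa using hη)
  obtain ⟨j, hj⟩ := (htend.eventually_const_lt hlt).exists
  have hj : 1 - ENNReal.ofReal η < μ (Y j) := hj
  obtain ⟨m, hmN, hmc⟩ := (((eventually_all_finset (Finset.range j)).2 fun i _ =>
    eventually_ge_atTop (N i)).and (hgrow.tendsto_card.eventually_ge_atTop
      ((Real.log 2 + Real.log (j + 1)) / κ))).exists
  have hspan : ∀ i ∈ Finset.range j, ∃ D : Finset X, (D.card : ℝ) ≤ Real.exp (s * (Fs m).card) ∧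
      ∀ x ∈ Zs i, ∃ z ∈ D, ∀ g ∈ Fs m, dist (act g x) (act g z) ≤ 2 * δ := fun i hi =>
    exists_spanning_of_packP_lt_one act Fs (hmN i hi) hδ (hN i)
  choose! D hDc hD using hspan
  refine ⟨m, insert (Classical.arbitrary X) ((Finset.range j).biUnion D),
    ⋃ x ∈ Y j, dynBall act (Fs m) x δ, Finset.insert_nonempty _ _,
    isOpen_biUnion fun x _ => isOpen_dynBall act hact _ _ _, ?_, ?_, ?_⟩
  · have ho : IsOpen (⋃ x ∈ Y j, dynBall act (Fs m) x δ) :=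
      isOpen_biUnion fun x _ => isOpen_dynBall act hact _ _ _
    have hsub : Y j ⊆ ⋃ x ∈ Y j, dynBall act (Fs m) x δ := fun x hx =>
      Set.mem_biUnion hx fun g _ => by rw [dist_self]; exact hδ
    rw [prob_compl_eq_one_sub ho.measurableSet]
    exact ENNReal.sub_lt_of_sub_lt prob_le_one (Or.inl ENNReal.one_ne_top)
      (hj.trans_le (measure_mono hsub))
  · intro y hy
    obtain ⟨x, hx, hxy⟩ := Set.mem_iUnion₂.1 hy
    obtain ⟨i, hi, hxi⟩ := Set.mem_iUnion₂.1 hx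
    obtain ⟨z, hz, hxz⟩ := hD i (Finset.mem_range.2 hi) x hxi
    refine ⟨z, Finset.mem_insert_of_mem (Finset.mem_biUnion.2 ⟨i, Finset.mem_range.2 hi, hz⟩),
      fun t ht => ?_⟩
    have h1 : dist (act t x) (act t y) < δ := hxy t ht
    have h2 := hxz t ht
    have := dist_triangle_left (act t y) (act t z) (act t x)
    linarith
  · have hcard : ((insert (Classical.arbitrary X) ((Finset.range j).biUnion D)).card : ℝ) ≤
        (j + 1) * Real.exp (s * (Fs m).card) := by
      have h1 : ((insert (Classical.arbitrary X) ((Finset.range j).biUnion D)).card : ℝ) ≤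
          ((Finset.range j).biUnion D).card + 1 := by
        exact_mod_cast Finset.card_insert_le _ _
      have h2 : (((Finset.range j).biUnion D).card : ℝ) ≤
          ∑ i ∈ Finset.range j, ((D i).card : ℝ) := by
        exact_mod_cast Finset.card_biUnion_le
      have h3 := Finset.sum_le_sum hDc
      rw [Finset.sum_const, Finset.card_range, nsmul_eq_mul] at h3
      have h4 : 1 ≤ Real.exp (s * (Fs m).card) := Real.one_le_exp (by positivity)
      linarith
    have hpos : (0 : ℝ) < (insert (Classical.arbitrary X) ((Finset.range j).biUnion D)).card := by
      exact_mod_cast (Finset.insert_nonempty _ _).card_pos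
    have hlog := Real.log_le_log hpos hcard
    rw [Real.log_mul (by positivity) (Real.exp_pos _).ne', Real.log_exp] at hlog
    rw [div_le_iff₀ hκ] at hmc
    linarith

/-- Countable covers by sets of small packing pre-measure bound the exponential growth rate of
separated sets. -/
theorem eventually_log_sepNum_le [Group G] [DecidableEq G] [MetricSpace X]
    [CompactSpace X] [Nonempty X] [MeasurableSpace X] [BorelSpace X] (act : G → X → X)
    (hmul : ∀ g h x, act (g * h) x = act g (act h x)) (hact : ∀ g, Continuous (act g))
    {Fs : ℕ → Finset G} (hF : Folner Fs) (hgrow : GrowthCond Fs) {s a ε : ℝ} (hs : 0 ≤ s)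
    (hsa : s < a) (hε : 0 < ε)
    (hcov : ∀ δ, 0 < δ → ∃ Zs : ℕ → Set X, Set.univ ⊆ ⋃ i, Zs i ∧
      ∀ i, ∃ N, packP act Fs (Zs i) N δ s < 1) :
    ∀ᶠ n in atTop, Real.log (sepNum act (Fs n) (Set.univ : Set X) ε) ≤ a * (Fs n).card := by
  classical
  by_contra hfreq
  rw [not_eventually] at hfreq
  choose E hEsep hEcard using fun n => exists_card_eq_sepNum (X := X) act hact (Fs n) hε
  have hEne : ∀ n, (E n).Nonempty := fun n =>
    Finset.card_pos.1 (hEcard n ▸ sepNum_pos act hact (Fs n) hε)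
  have := frequently_iff_neBot.1 hfreq
  set l := Ultrafilter.of (atTop ⊓ 𝓟 {n | ¬Real.log (sepNum act (Fs n) (Set.univ : Set X) ε) ≤
    a * (Fs n).card})
  have hle := Ultrafilter.of_le (atTop ⊓ 𝓟 {n | ¬Real.log (sepNum act (Fs n) (Set.univ : Set X) ε) ≤
    a * (Fs n).card})
  have hl_top : (l : Filter ℕ) ≤ atTop := hle.trans inf_le_left
  have hl_mem : ∀ᶠ n in (l : Filter ℕ), ¬Real.log (sepNum act (Fs n) (Set.univ : Set X) ε) ≤
      a * (Fs n).card := (hle.trans inf_le_right) (mem_principal_self _)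
  obtain ⟨μ, hμ⟩ := exists_limit_measure act E Fs hEne hF.1 l
  obtain ⟨κ, hκ, hκa⟩ : ∃ κ : ℝ, 0 < κ ∧ s + 6 * κ = a := ⟨(a - s) / 6, by linarith, by ring⟩
  obtain ⟨θ, hθ, hθ1, hθκ⟩ : ∃ θ : ℝ, 0 < θ ∧ θ < 1 ∧ Real.log (1 - θ)⁻¹ = κ :=
    ⟨1 - Real.exp (-κ), by simpa using hκ, by simpa using Real.exp_pos _,
      by rw [_root_.sub_sub_cancel, Real.exp_neg, inv_inv, Real.log_exp]⟩
  obtain ⟨S, P, hP, hPW⟩ := exists_partition (μ : Measure X) hε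
  set L : ℝ := (Fintype.card (S → Bool) : ℝ) with hL
  have hL1 : 1 ≤ L := Nat.one_le_cast.2 (Fintype.card_pos (α := S → Bool))
  have hLL : L ≤ L / θ := le_div_self (by linarith) hθ hθ1.le
  have hL0 : 0 ≤ Real.log L := Real.log_nonneg hL1
  have hΛ : 0 < Real.log (L / θ) := Real.log_pos ((one_lt_div hθ).2 (by linarith))
  have hLΛ : Real.log L ≤ Real.log (L / θ) := Real.log_le_log (by linarith) hLL
  obtain ⟨η, hη, hηκ⟩ : ∃ η : ℝ, 0 < η ∧ η * Real.log (L / θ) = κ :=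
    ⟨κ / Real.log (L / θ), by positivity, div_mul_cancel₀ _ hΛ.ne'⟩
  obtain ⟨γ, W, hγ, hWc, hWμ, hW⟩ := hPW η hη
  obtain ⟨Zs, hZ, hZs⟩ := hcov (γ / 3) (by positivity)
  obtain ⟨m, D, U, hDne, hUo, hUμ, hUD, hDlog⟩ := exists_spanning_of_cover act hact hgrow
    (μ : Measure X) hs (by positivity) hη hκ Zs hZ hZs
  set T := Fs m with hT
  have hvU := hμ Uᶜ η hUo.isClosed_compl hUμ
  have hvW := hμ W η hWc hWμ
  obtain ⟨n, hn, hnU, hnW, hn1, hn2⟩ := (hl_mem.and (hvU.and (hvW.and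
    (((hF.eventually_sum_card_sdiff_le T id hη).filter_mono hl_top).and
      ((hF.eventually_sum_card_sdiff_le T (·⁻¹) hη).filter_mono hl_top))))).exists
  have hinj : ∀ x ∈ E n, ∀ y ∈ E n, (∀ g ∈ Fs n, P (act g x) = P (act g y)) → x = y := by
    intro x hx y hy h
    by_contra hne
    obtain ⟨g, hg, hlt⟩ := hEsep n x hx y hy hne
    exact absurd (hP _ _ (h g hg)) (not_le.2 hlt)
  have hUP : ∀ y ∈ U, ∃ z ∈ D, ∀ t ∈ T, P (act t y) = P (act t z) ∨ act t y ∈ W := by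
    intro y hy
    obtain ⟨z, hz, h⟩ := hUD y hy
    refine ⟨z, hz, fun t ht => or_iff_not_imp_right.2 fun hyW => hW _ _ ?_ hyW⟩
    simpa [mul_div_cancel₀] using h t ht
  have key := card_mul_log_card_le act hmul (E n) P (Fs n) T hinj D hDne U W hUP hθ hθ1
  rw [← hL, hθκ] at key
  have ht : (1 : ℝ) ≤ T.card := by exact_mod_cast (hF.1 m).card_pos
  have he : (0 : ℝ) < (E n).card := by exact_mod_cast (hEne n).card_pos
  have hf : (0 : ℝ) < (Fs n).card := by exact_mod_cast (hF.1 n).card_pos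
  rw [not_le, ← hEcard n] at hn
  simp only [id] at hn1
  set t : ℝ := (T.card : ℝ)
  set e : ℝ := ((E n).card : ℝ)
  set f : ℝ := ((Fs n).card : ℝ)
  set Λ := Real.log (L / θ)
  have h1 : f * (e * (Real.log 2 + Real.log D.card + t * κ)) ≤ f * (e * ((s + κ) * t + t * κ)) := by
    gcongr
  have h2 : (visitCount act (E n) (Fs n) Uᶜ : ℝ) * (t * Real.log L) ≤ η * (e * f) * (t * Λ) := by
    gcongr
  have h3 := mul_le_mul_of_nonneg_right (add_le_add (mul_le_mul_of_nonneg_left hnW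
    (zero_le_one.trans ht)) (mul_le_mul_of_nonneg_right hn1 he.le)) hΛ.le
  have h4 := mul_le_mul hn2 (mul_le_mul_of_nonneg_left (mul_le_mul_of_nonneg_left hLΛ
    (zero_le_one.trans ht)) he.le) (by positivity) (by positivity)
  have h5 : t * (e * (a * f)) < t * (e * Real.log e) := by gcongr
  have h6 : κ * (e * f) ≤ t * (κ * (e * f)) := le_mul_of_one_le_left (by positivity) ht
  rw [← hκa] at h5
  have h7 : η * (e * f) * (t * Λ) = κ * t * e * f := by rw [← hηκ]; ring
  have h8 : (t * (η * (e * f)) + η * f * e) * Λ = κ * t * e * f + κ * (e * f) := by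
    rw [← hηκ]; ring
  have h9 : η * f * (e * (t * Λ)) = κ * t * e * f := by rw [← hηκ]; ring
  rw [h7] at h2
  rw [h8] at h3
  rw [h9] at h4
  linarith

theorem packP_anti [PseudoMetricSpace X] (act : G → X → X) (Fs : ℕ → Finset G) (Z : Set X) (N : ℕ)
    (ε : ℝ) : Antitone (packP act Fs Z N ε) := by
  intro s s' h
  refine iSup₂_mono fun t c => iSup₂_mono fun _ _ => ENNReal.tsum_le_tsum fun i => ?_
  gcongr

theorem ucEntEps_univ_le_packEnt [Group G] [DecidableEq G] [MetricSpace X]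
    [CompactSpace X] [MeasurableSpace X] [BorelSpace X] (act : G → X → X)
    (hmul : ∀ g h x, act (g * h) x = act g (act h x)) (hact : ∀ g, Continuous (act g))
    {Fs : ℕ → Finset G} (hF : Folner Fs) (hgrow : GrowthCond Fs) {ε : ℝ} (hε : 0 < ε) :
    ucEntEps act Fs (Set.univ : Set X) ε ≤ packEnt act Fs (Set.univ : Set X) := by
  rcases isEmpty_or_nonempty X with hX | hX
  · have : ∀ n, sepNum act (Fs n) (Set.univ : Set X) ε = 0 := fun n => by
      obtain ⟨E, -, h⟩ := exists_card_eq_sepNum (X := X) act hact (Fs n) hε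
      rw [← h, Finset.eq_empty_of_isEmpty E, Finset.card_empty]
    simp [ucEntEps, this]
  refine le_of_forall_gt fun b hb => ?_
  obtain ⟨s, hs, hsb⟩ := ENNReal.lt_iff_exists_nnreal_btwn.1 hb
  obtain ⟨a, hsa, hab⟩ := ENNReal.lt_iff_exists_nnreal_btwn.1 hsb
  refine lt_of_le_of_lt ?_ hab
  have hcov : ∀ δ, 0 < δ → ∃ Zs : ℕ → Set X, Set.univ ⊆ ⋃ i, Zs i ∧
      ∀ i, ∃ N, packP act Fs (Zs i) N δ s < 1 := by
    intro δ hδ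
    have h1 : packEntEps act Fs (Set.univ : Set X) δ < s :=
      lt_of_le_of_lt (le_iSup₂ (f := fun δ (_ : 0 < δ) => packEntEps act Fs Set.univ δ) δ hδ) hs
    simp only [packEntEps, iInf_lt_iff] at h1
    obtain ⟨s₀, h0, hs₀⟩ := h1
    have h2 : packOuter act Fs (Set.univ : Set X) δ s₀ < 1 := h0 ▸ one_pos
    simp only [packOuter, iInf_lt_iff] at h2
    obtain ⟨Zs, hZ, hsum⟩ := h2
    refine ⟨Zs, hZ, fun i => ?_⟩
    obtain ⟨N, hN⟩ := iInf_lt_iff.1 ((ENNReal.le_tsum i).trans_lt hsum)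
    exact ⟨N, (packP_anti act Fs _ N δ (by exact_mod_cast hs₀.le)).trans_lt hN⟩
  refine limsup_le_of_le (by isBoundedDefault) ?_
  filter_upwards [eventually_log_sepNum_le act hmul hact hF hgrow s.2
    (show (s : ℝ) < a by exact_mod_cast hsa) hε hcov] with n hn
  have hc : (0 : ℝ) < (Fs n).card := by exact_mod_cast (hF.1 n).card_pos
  rw [← ENNReal.ofReal_coe_nnreal]
  exact ENNReal.ofReal_le_ofReal ((div_le_iff₀ hc).2 hn)

end LowerBound

theorem packing_entropy_univ_eq_topological_entropy
    [Group G] [Countable G] [Infinite G] [DecidableEq G]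
    [MetricSpace X] [CompactSpace X] [MeasurableSpace X] [BorelSpace X]
    (act : G → X → X)
    (hact_one : ∀ x, act 1 x = x)
    (hact_mul : ∀ g h x, act (g * h) x = act g (act h x))
    (hact_cont : ∀ g : G, Continuous (act g))
    (Fs : ℕ → Finset G) (hFol : Folner Fs) (hgrow : GrowthCond Fs) :
    packEnt act Fs (Set.univ : Set X) = ucEnt act Fs (Set.univ : Set X) := by
  refine le_antisymm ?_ ?_
  · exact iSup₂_mono fun ε hε => packEntEps_univ_le_ucEntEps act hact_cont hFol.1 hgrow hε
  · exact iSup₂_le fun ε hε => ucEntEps_univ_le_packEnt act hact_mul hact_cont hFol hgrow hε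

end AmenablePacking
end

section
/- Monotonicity of the packing pre-measure under closure and radius change: Let {F_n} be a sequence of finite subsets of G satisfying the growth condition, let E ⊆ X, s > 0, and 0 < ε₁ < ε₂. Then P(Ē, ε₂, s, {F_n}) ≤ P(E, ε₁, s, {F_n}), where Ē denotes the closure of E in X. -/
open Filter Set MeasureTheory ENNReal Topology
open scoped Pointwise symmDiff NNReal

namespace AmenablePacking

variable {G X Y : Type*}

/-- Closed Bowen balls are nested as soon as the centers are close in the Bowen metric. -/
lemma dynClosedBall_subset [PseudoMetricSpace X] {act : G → X → X} {F : Finset G} {x y : X}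
    {δ ε : ℝ} (h : y ∈ dynClosedBall act F x δ) :
    dynClosedBall act F y ε ⊆ dynClosedBall act F x (δ + ε) := fun _ hz g hg =>
  (dist_triangle _ _ _).trans (add_le_add (h g hg) (hz g hg))

/-- A point of the closure of `E` is approximated by points of `E` in the Bowen metric. -/
lemma exists_mem_dynClosedBall_of_mem_closure [PseudoMetricSpace X] {act : G → X → X}
    (hact : ∀ g, Continuous (act g)) (F : Finset G) {E : Set X} {x : X} (hx : x ∈ closure E)
    {δ : ℝ} (hδ : 0 < δ) : ∃ y ∈ E, y ∈ dynClosedBall act F x δ := by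
  have hball : dynClosedBall act F x δ ∈ 𝓝 x := by
    refine (Filter.eventually_all_finset F).2 fun g _ => ?_
    filter_upwards [(hact g).continuousAt.eventually (Metric.closedBall_mem_nhds (act g x) hδ)]
      with y hy
    rwa [dist_comm]
  obtain ⟨y, hy, hyE⟩ := mem_closure_iff_nhds.1 hx _ hball
  exact ⟨y, hyE, hy⟩

/-- The inequality between packing pre-measures holds already at every level `N`. -/
lemma packP_closure_le_packP [PseudoMetricSpace X] {act : G → X → X}
    (hact : ∀ g, Continuous (act g)) (Fs : ℕ → Finset G) (E : Set X) (N : ℕ) (s : ℝ)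
    {ε₁ ε₂ : ℝ} (hε : ε₁ < ε₂) :
    packP act Fs (closure E) N ε₂ s ≤ packP act Fs E N ε₁ s := by
  refine iSup_le fun t => iSup_le fun c => iSup_le fun hc => iSup_le fun hdisj => ?_
  have happrox : ∀ i, ∃ y, i ∈ t → y ∈ E ∧ y ∈ dynClosedBall act (Fs (c i).2) (c i).1 (ε₂ - ε₁) :=
    fun i => by
      by_cases hi : i ∈ t
      · obtain ⟨y, hy⟩ := exists_mem_dynClosedBall_of_mem_closure hact (Fs (c i).2) (hc i hi).1
          (sub_pos.2 hε)
        exact ⟨y, fun _ => hy⟩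
      · exact ⟨(c i).1, fun h => absurd h hi⟩
  choose y hy using happrox
  have hsub : ∀ i ∈ t, dynClosedBall act (Fs (c i).2) (y i) ε₁ ⊆
      dynClosedBall act (Fs (c i).2) (c i).1 ε₂ := fun i hi => by
    simpa using dynClosedBall_subset (ε := ε₁) (hy i hi).2
  exact le_iSup_of_le t <| le_iSup_of_le (fun i => (y i, (c i).2)) <|
    le_iSup_of_le (fun i hi => ⟨(hy i hi).1, (hc i hi).2⟩) <|
    le_iSup_of_le (fun i hi j hj hij => (hdisj i hi j hj hij).mono (hsub i hi) (hsub j hj)) le_rfl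

theorem packP_closure_le
    [Group G] [Countable G] [Infinite G] [DecidableEq G]
    [MetricSpace X] [CompactSpace X] [MeasurableSpace X] [BorelSpace X]
    (act : G → X → X)
    (hact_one : ∀ x, act 1 x = x)
    (hact_mul : ∀ g h x, act (g * h) x = act g (act h x))
    (hact_cont : ∀ g : G, Continuous (act g))
    (hamen : ∃ E : ℕ → Finset G, Folner E)
    (Fs : ℕ → Finset G) (hne : ∀ n, (Fs n).Nonempty) (hgrow : GrowthCond Fs)
    (E : Set X) (s : ℝ) (hs : 0 < s) (ε₁ ε₂ : ℝ) (hε₁ : 0 < ε₁) (hε : ε₁ < ε₂) :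
    packPLim act Fs (closure E) ε₂ s ≤ packPLim act Fs E ε₁ s := by
  exact iInf_mono fun N => packP_closure_le_packP hact_cont Fs E N s hε

end AmenablePacking
end

section
/- Intermediate value property of the packing pre-measure: Let {F_n} be a sequence of finite subsets of G satisfying the growth condition, let Z ⊆ X and s, ε > 0, and assume 𝒫(Z,ε,s,{F_n}) = +∞. Then for any finite interval (a,b) ⊂ ℝ with a ≥ 0 and any N ∈ ℕ, there exists a finite pairwise disjoint collection {B̄_{F_{n_i}}(x_i,ε)} with x_i ∈ Z and n_i ≥ N for all i such that Σ_i exp(−|F_{n_i}| s) ∈ (a,b). -/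
open Filter Set MeasureTheory ENNReal Topology
open scoped Pointwise symmDiff NNReal

namespace AmenablePacking

variable {G X Y : Type*}

/-- A finite sum of terms smaller than `b - a` which exceeds `a ≥ 0` has a subsum in `(a, b)`. -/
theorem exists_subset_sum_mem_Ioo {ι : Type*} (f : ι → ℝ) {a b : ℝ} (ha : 0 ≤ a) (J : Finset ι)
    (hf : ∀ i ∈ J, f i < b - a) (hJ : a < ∑ i ∈ J, f i) :
    ∃ I ⊆ J, ∑ i ∈ I, f i ∈ Ioo a b := by
  classical
  induction J using Finset.induction_on with
  | empty => exact absurd hJ (by simpa using ha)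
  | insert j J hj ih =>
    rcases lt_or_ge a (∑ i ∈ J, f i) with h | h
    · obtain ⟨I, hI, hsum⟩ := ih (fun i hi => hf i (Finset.mem_insert_of_mem hi)) h
      exact ⟨I, hI.trans (Finset.subset_insert j J), hsum⟩
    · refine ⟨insert j J, subset_rfl, hJ, ?_⟩
      rw [Finset.sum_insert hj]
      linarith [hf j (Finset.mem_insert_self j J)]

theorem packP_empty [PseudoMetricSpace X] (act : G → X → X) (Fs : ℕ → Finset G) (N : ℕ)
    (ε s : ℝ) : packP act Fs ∅ N ε s = 0 := by
  simp only [packP, ENNReal.iSup_eq_zero]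
  intro t c ht _
  have : IsEmpty t := ⟨fun i => (ht i i.2).1⟩
  exact tsum_empty

theorem packOuter_le_packPLim [PseudoMetricSpace X] (act : G → X → X) (Fs : ℕ → Finset G)
    (Z : Set X) (ε s : ℝ) : packOuter act Fs Z ε s ≤ packPLim act Fs Z ε s := by
  refine (iInf₂_le (fun i => if i = 0 then Z else ∅)
    (subset_iUnion_of_subset 0 (by simp))).trans ?_
  rw [tsum_eq_single 0 fun i hi => by simp [hi, packPLim, packP_empty]]
  simp

/-- If the packing pre-measure exceeds `a`, so does the sum over some finite packing. -/
theorem exists_finset_of_lt_packP [PseudoMetricSpace X] {act : G → X → X} {Fs : ℕ → Finset G}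
    {Z : Set X} {N : ℕ} {ε s a : ℝ} (h : ENNReal.ofReal a < packP act Fs Z N ε s) :
    ∃ (J : Finset ℕ) (c : ℕ → X × ℕ),
      (∀ i ∈ J, (c i).1 ∈ Z ∧ N ≤ (c i).2) ∧
      (∀ i ∈ J, ∀ j ∈ J, i ≠ j →
        Disjoint (dynClosedBall act (Fs (c i).2) (c i).1 ε)
          (dynClosedBall act (Fs (c j).2) (c j).1 ε)) ∧
      a < ∑ i ∈ J, Real.exp (-((Fs (c i).2).card : ℝ) * s) := by
  simp only [packP, lt_iSup_iff] at h
  obtain ⟨t, c, hc, hd, hlt⟩ := h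
  rw [ENNReal.tsum_eq_iSup_sum, lt_iSup_iff] at hlt
  obtain ⟨J, hJ⟩ := hlt
  have hmem : ∀ i ∈ J.map (Function.Embedding.subtype (· ∈ t)), i ∈ t := fun i hi => by
    obtain ⟨k, -, rfl⟩ := Finset.mem_map.1 hi
    exact k.2
  refine ⟨J.map (Function.Embedding.subtype (· ∈ t)), c, fun i hi => hc i (hmem i hi),
    fun i hi j hj => hd i (hmem i hi) j (hmem j hj), ?_⟩
  rw [← ENNReal.ofReal_sum_of_nonneg fun i _ => (Real.exp_pos _).le] at hJ
  rw [Finset.sum_map]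
  convert (ENNReal.ofReal_lt_ofReal_iff'.1 hJ).1 using 3
  simp only [Function.Embedding.subtype_apply]
  ring

theorem packP_intermediate_value
    [Group G] [Countable G] [Infinite G] [DecidableEq G]
    [MetricSpace X] [CompactSpace X] [MeasurableSpace X] [BorelSpace X]
    (act : G → X → X)
    (hact_one : ∀ x, act 1 x = x)
    (hact_mul : ∀ g h x, act (g * h) x = act g (act h x))
    (hact_cont : ∀ g : G, Continuous (act g))
    (hamen : ∃ E : ℕ → Finset G, Folner E)
    (Fs : ℕ → Finset G) (hne : ∀ n, (Fs n).Nonempty) (hgrow : GrowthCond Fs)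
    (Z : Set X) (s ε : ℝ) (hs : 0 < s) (hε : 0 < ε)
    (hinfty : packOuter act Fs Z ε s = ⊤)
    (a b : ℝ) (ha : 0 ≤ a) (hab : a < b) (N : ℕ) :
    ∃ (I : Finset ℕ) (c : ℕ → X × ℕ),
      (∀ i ∈ I, (c i).1 ∈ Z ∧ N ≤ (c i).2) ∧
      (∀ i ∈ I, ∀ j ∈ I, i ≠ j →
        Disjoint (dynClosedBall act (Fs (c i).2) (c i).1 ε)
          (dynClosedBall act (Fs (c j).2) (c j).1 ε)) ∧
      a < ∑ i ∈ I, Real.exp (-((Fs (c i).2).card : ℝ) * s) ∧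
      ∑ i ∈ I, Real.exp (-((Fs (c i).2).card : ℝ) * s) < b := by
  have hexp : Tendsto (fun n => Real.exp (-((Fs n).card : ℝ) * s)) atTop (𝓝 0) := by
    simp only [neg_mul]
    exact Real.tendsto_exp_neg_atTop_nhds_zero.comp (hgrow.tendsto_card.atTop_mul_const hs)
  obtain ⟨M, hM⟩ := eventually_atTop.1 (hexp.eventually_lt_const (sub_pos.2 hab))
  have htop : packP act Fs Z (max N M) ε s = ⊤ :=
    top_le_iff.1 <| hinfty ▸ (packOuter_le_packPLim act Fs Z ε s).trans (iInf_le _ _)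
  obtain ⟨J, c, hc, hd, hJ⟩ := exists_finset_of_lt_packP (htop ▸ ENNReal.ofReal_lt_top (r := a))
  obtain ⟨I, hIJ, hI⟩ := exists_subset_sum_mem_Ioo _ ha J
    (fun i hi => hM _ ((le_max_right N M).trans (hc i hi).2)) hJ
  exact ⟨I, c, fun i hi => ⟨(hc i (hIJ hi)).1, (le_max_left N M).trans (hc i (hIJ hi)).2⟩,
    fun i hi j hj => hd i (hIJ hi) j (hIJ hj), hI.1, hI.2⟩

end AmenablePacking
end
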